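/- arXiv:2407.19230 — 2 statements merged into one kernel-verified Lean document; each statement's English description precedes it below -/
import Mathlib

section
/- Let p ≥ 5 be a prime number and suppose w_1(p) ≢ 0 (mod 2). Then for all nonnegative integers n and k with p ∤ n, we have B_{4,3}( p^{6k+5} n + 5(p^{6k+6} − 1)/24 ) ≡ 0 (mod 2). -/
/-- The number of `t`-regular partitions of `n`, i.e. partitions of `n`
none of whose parts is divisible by `t`. -/
noncomputable def regularPartitionCount (t n : ℕ) : ℕ :=
  Nat.card {π : n.Partition // ∀ x ∈ π.parts, ¬ t ∣ x}

/-- `B u v n` is the number of `(u,v)`-regular bipartitions of `n`: pairs `(α, β)` of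
partitions with `|α| + |β| = n`, `α` being `u`-regular and `β` being `v`-regular. -/
noncomputable def B (u v n : ℕ) : ℕ :=
  ∑ i ∈ Finset.range (n + 1), regularPartitionCount u i * regularPartitionCount v (n - i)

/-- `a1 n` is the coefficient of `q^n` in `∏ (1 - q^k)^2 (1 - q^{3k})`. -/
noncomputable def a1 (n : ℕ) : ℤ :=
  (∏ k ∈ Finset.Icc 1 n,
      ((1 - Polynomial.X ^ k) ^ 2 * (1 - Polynomial.X ^ (3 * k)) : Polynomial ℤ)).coeff n

/-- `w1 p = a1(5(p²−1)/24) + (−6/p)_L (−5(p²−1)/24 / p)_L` for a prime `p ≥ 5`. -/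
noncomputable def w1 (p : ℕ) (hp : p.Prime) : ℤ :=
  a1 (5 * (p ^ 2 - 1) / 24)
    + @legendreSym p ⟨hp⟩ (-6) * @legendreSym p ⟨hp⟩ (-((5 * (p ^ 2 - 1) / 24 : ℕ) : ℤ))

/-- If `-6` is a square modulo the prime `p`, then `p` is represented by one of the two reduced
binary quadratic forms of discriminant `-24`. -/
theorem exists_sq_add_six_mul_sq_or {p : ℕ} (hp : p.Prime) {r : ℤ} (hr : (p : ℤ) ∣ r ^ 2 + 6) :
    ∃ a b : ℤ, a ^ 2 + 6 * b ^ 2 = p ∨ 2 * a ^ 2 + 3 * b ^ 2 = p := by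
  have : NeZero p := ⟨hp.ne_zero⟩
  set m := Nat.sqrt p with hm
  have hlt : p < (m + 1) * (m + 1) := Nat.lt_succ_sqrt p
  have hle : m * m < p := by
    refine lt_of_le_of_ne (Nat.sqrt_le p) fun h => ?_
    exact hp.not_isSquare ⟨m, h.symm⟩
  obtain ⟨z, w, hzw, hf⟩ := Fintype.exists_ne_map_eq_of_card_lt
    (fun z : Fin (m + 1) × Fin (m + 1) =>
      ((z.1 : ℕ) : ZMod p) - (r : ZMod p) * ((z.2 : ℕ) : ZMod p))
    (by simpa using hlt)
  obtain ⟨x, y, hx, hy, hxy, hd⟩ : ∃ x y : ℤ, x ^ 2 < p ∧ y ^ 2 < p ∧ (x ≠ 0 ∨ y ≠ 0) ∧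
      (p : ℤ) ∣ x - r * y := by
    have key (a b : Fin (m + 1)) : (((a : ℕ) : ℤ) - ((b : ℕ) : ℤ)) ^ 2 < p := by
      have ha := a.2
      have hb := b.2
      have : ((m * m : ℕ) : ℤ) < p := by exact_mod_cast hle
      push_cast at this
      nlinarith
    refine ⟨(z.1 : ℕ) - (w.1 : ℕ), (z.2 : ℕ) - (w.2 : ℕ), key _ _, key _ _, ?_, ?_⟩
    · by_contra! h
      apply hzw
      ext <;> omega
    · rw [← ZMod.intCast_zmod_eq_zero_iff_dvd]
      push_cast
      linear_combination hf
  obtain ⟨k, hk⟩ : (p : ℤ) ∣ x ^ 2 + 6 * y ^ 2 := by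
    obtain ⟨c, hc⟩ := hd
    obtain ⟨d, hd⟩ := hr
    exact ⟨c * (x + r * y) + d * y ^ 2, by linear_combination (x + r * y) * hc + y ^ 2 * hd⟩
  have hp0 : (0 : ℤ) < p := by exact_mod_cast hp.pos
  have hk0 : 0 < k := by
    have : 0 < (p : ℤ) * k := by
      rw [← hk]
      rcases hxy with h | h <;> positivity
    exact pos_of_mul_pos_right this hp0.le
  have hk7 : k < 7 := by nlinarith
  have h2 (a b : ℤ) (h : a ^ 2 = 2 * b) : 2 ∣ a :=
    Int.prime_two.dvd_of_dvd_pow (n := 2) ⟨b, h⟩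
  have h3 (a b : ℤ) (h : a ^ 2 = 3 * b) : 3 ∣ a :=
    Int.prime_three.dvd_of_dvd_pow (n := 2) ⟨b, h⟩
  interval_cases k
  · exact ⟨x, y, .inl (by linarith)⟩
  · obtain ⟨a, rfl⟩ := h2 x (p - 3 * y ^ 2) (by linarith)
    exact ⟨a, y, .inr (by linarith)⟩
  · obtain ⟨a, rfl⟩ := h3 x (p - 2 * y ^ 2) (by linarith)
    exact ⟨y, a, .inr (by linarith)⟩
  · obtain ⟨a, rfl⟩ := h2 x (2 * p - 3 * y ^ 2) (by linarith)
    obtain ⟨b, rfl⟩ := h2 y (p - a ^ 2 - y ^ 2) (by linarith)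
    exact ⟨a, b, .inl (by linarith)⟩
  · have h5 : (5 : ℤ) ∣ (x - 2 * y) * (x + 2 * y) := ⟨p - 2 * y ^ 2, by linarith⟩
    rcases Int.Prime.dvd_mul' (p := 5) (by norm_num) h5 with ⟨b, hb⟩ | ⟨b, hb⟩
    · exact ⟨b + y, b, .inr (by push_cast at hb; obtain rfl : x = 5 * b + 2 * y := by linarith
                                linarith)⟩
    · exact ⟨b - y, b, .inr (by push_cast at hb; obtain rfl : x = 5 * b - 2 * y := by linarith
                                linarith)⟩
  · obtain ⟨a, rfl⟩ := h2 x (3 * p - 3 * y ^ 2) (by linarith)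
    obtain ⟨b, rfl⟩ := h3 a (a ^ 2 - p + y ^ 2) (by linarith)
    exact ⟨y, b, .inl (by linarith)⟩

theorem exists_sq_add_six_mul_sq_eq_prime_sq {p : ℕ} (hp : p.Prime) (hp5 : 5 ≤ p) {r : ℤ}
    (hr : (p : ℤ) ∣ r ^ 2 + 6) :
    ∃ u v : ℤ, u ^ 2 + 6 * v ^ 2 = (p : ℤ) ^ 2 ∧ v ≠ 0 ∧ (u : ZMod 3) = 1 := by
  obtain ⟨u, v, h, hv⟩ : ∃ u v : ℤ, u ^ 2 + 6 * v ^ 2 = (p : ℤ) ^ 2 ∧ v ≠ 0 := by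
    have hpi : Prime (p : ℤ) := Nat.prime_iff_prime_int.mp hp
    have hp0 : (5 : ℤ) ≤ p := by exact_mod_cast hp5
    have hnd (c : ℤ) (h1 : 0 < c) (h2 : c < 5) : ¬ (p : ℤ) ∣ c := fun h => by
      have := Int.le_of_dvd h1 h
      omega
    have hsq (a c : ℤ) (h1 : 0 < c) (h2 : c < 5) : c * a ^ 2 ≠ p := by
      intro h
      have hpa : (p : ℤ) ∣ a := by
        have : (p : ℤ) ∣ c * a ^ 2 := h ▸ dvd_rfl
        exact hpi.dvd_of_dvd_pow ((hpi.dvd_or_dvd this).resolve_left (hnd c h1 h2))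
      obtain ⟨e, rfl⟩ := hpa
      have : c * p * e ^ 2 = 1 := by
        apply mul_left_cancel₀ hpi.ne_zero
        linear_combination h
      have h4 := Int.isUnit_iff.mp (IsUnit.of_mul_eq_one _ (show (p : ℤ) * (c * e ^ 2) = 1 by
        linear_combination this))
      omega
    have h6 (b : ℤ) : 6 * b ^ 2 ≠ p := fun h => by
      have h2 : (2 : ℤ) ∣ p := ⟨3 * b ^ 2, by linarith⟩
      have := (Nat.prime_dvd_prime_iff_eq Nat.prime_two hp).mp (by exact_mod_cast h2)
      omega
    obtain ⟨a, b, h | h⟩ := exists_sq_add_six_mul_sq_or hp hr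
    · refine ⟨a ^ 2 - 6 * b ^ 2, 2 * a * b, by rw [← h]; ring, ?_⟩
      rintro h0
      rcases mul_eq_zero.mp h0 with h0 | rfl
      · obtain rfl : a = 0 := by linarith
        exact h6 b (by linarith)
      · exact hsq a 1 (by norm_num) (by norm_num) (by linarith)
    · refine ⟨2 * a ^ 2 - 3 * b ^ 2, 2 * a * b, by rw [← h]; ring, ?_⟩
      rintro h0
      rcases mul_eq_zero.mp h0 with h0 | rfl
      · obtain rfl : a = 0 := by linarith
        exact hsq b 3 (by norm_num) (by norm_num) (by linarith)
      · exact hsq a 2 (by norm_num) (by norm_num) (by linarith)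
  have hu : (u : ZMod 3) = 1 ∨ (u : ZMod 3) = -1 := by
    have h' : ((u ^ 2 + 6 * v ^ 2 : ℤ) : ZMod 3) = ((p ^ 2 : ℤ) : ZMod 3) := by rw [h]
    have hp3 : (p : ZMod 3) ≠ 0 := by
      rw [Ne, ZMod.natCast_eq_zero_iff, Nat.prime_dvd_prime_iff_eq Nat.prime_three hp]
      omega
    push_cast at h'
    generalize (u : ZMod 3) = u' at *
    generalize (v : ZMod 3) = v' at *
    generalize (p : ZMod 3) = p' at *
    revert u' v' p'
    decide
  rcases hu with hu | hu
  · exact ⟨u, v, h, hv, hu⟩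
  · exact ⟨-u, v, by linarith, hv, by simp [hu]⟩

/-- The solutions of `2 x ^ 2 + 3 y ^ 2 = N` with `x ≡ 1` and `y ≡ t` modulo `3`. -/
def formSols (N : ℤ) (t : ZMod 3) : Set (ℤ × ℤ) :=
  {z | 2 * z.1 ^ 2 + 3 * z.2 ^ 2 = N ∧ (z.1 : ZMod 3) = 1 ∧ (z.2 : ZMod 3) = t}

theorem finite_formSols (N : ℤ) (t : ZMod 3) : (formSols N t).Finite := by
  refine ((Set.finite_Icc (-N) N).prod (Set.finite_Icc (-N) N)).subset ?_
  rintro ⟨x, y⟩ ⟨h, -, -⟩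
  simp only [Set.mem_prod, Set.mem_Icc] at h ⊢
  refine ⟨⟨?_, ?_⟩, ?_, ?_⟩ <;> nlinarith

theorem ncard_formSols_neg (N : ℤ) (t : ZMod 3) :
    (formSols N (-t)).ncard = (formSols N t).ncard := by
  rw [← Set.ncard_image_of_injective (formSols N t) (f := fun z : ℤ × ℤ => (z.1, -z.2))]
  · congr 1
    ext ⟨x, y⟩
    simp only [formSols, Set.mem_ofPred_eq, Set.mem_image, Prod.mk.injEq, Prod.exists]
    constructor
    · rintro ⟨h1, h2, h3⟩
      exact ⟨x, -y, ⟨by linarith, h2, by simp [h3]⟩, rfl, neg_neg y⟩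
    · rintro ⟨x', y', ⟨h1, h2, h3⟩, rfl, rfl⟩
      exact ⟨by linarith, h2, by simp [h3]⟩
  · rintro ⟨x, y⟩ ⟨x', y'⟩ h
    simpa using h

theorem even_ncard_formSols_zero {N : ℤ} (hN : Odd N) : Even (formSols N 0).ncard := by
  have hy (z) (hz : z ∈ formSols N 0) : z.2 ≠ 0 := by
    intro h0
    have := hz.1
    rw [h0] at this
    exact Int.not_even_iff_odd.mpr hN ⟨z.1 ^ 2, by linarith⟩
  set P := {z ∈ formSols N 0 | 0 < z.2}
  have hP : P.Finite := (finite_formSols N 0).subset (Set.sep_subset _ _)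
  have hinj : Function.Injective (fun z : ℤ × ℤ => (z.1, -z.2)) := by
    rintro ⟨x, y⟩ ⟨x', y'⟩ h
    simpa using h
  have h : formSols N 0 = P ∪ (fun z : ℤ × ℤ => (z.1, -z.2)) '' P := by
    ext ⟨x, y⟩
    simp only [Set.mem_union, Set.mem_image, Prod.mk.injEq, Prod.exists, P, Set.mem_sep_iff]
    constructor
    · intro hz
      rcases (hy _ hz).lt_or_gt with h | h
      · exact .inr ⟨x, -y, ⟨⟨by linarith [hz.1], hz.2.1, by simpa using hz.2.2⟩, by simpa using h⟩,
          rfl, neg_neg y⟩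
      · exact .inl ⟨hz, h⟩
    · rintro (h | ⟨x', y', ⟨h, -⟩, rfl, rfl⟩)
      · exact h.1
      · exact ⟨by linarith [h.1], h.2.1, by simpa using h.2.2⟩
  rw [h, Set.ncard_union_eq _ hP (hP.image _), Set.ncard_image_of_injective _ hinj]
  · exact ⟨_, rfl⟩
  · rw [Set.disjoint_left]
    rintro ⟨x, y⟩ ⟨-, h1⟩ ⟨⟨x', y'⟩, ⟨-, h2⟩, h3⟩
    simp only [Prod.mk.injEq] at h1 h2 h3
    omega

/-- Multiplication of `2 x + y √-6` by `u + v √-6`. -/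
def formMul (u v : ℤ) (z : ℤ × ℤ) : ℤ × ℤ :=
  (z.1 * u - 3 * z.2 * v, z.2 * u + 2 * z.1 * v)

theorem formMul_injective {u v c : ℤ} (hc : c ≠ 0) (h : u ^ 2 + 6 * v ^ 2 = c) :
    Function.Injective (formMul u v) := by
  rintro ⟨x, y⟩ ⟨x', y'⟩ hz
  simp only [formMul, Prod.mk.injEq] at hz ⊢
  obtain ⟨h1, h2⟩ := hz
  constructor <;> apply mul_left_cancel₀ hc <;> rw [← h]
  · linear_combination u * h1 + 3 * v * h2
  · linear_combination u * h2 - 2 * v * h1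

theorem formMul_mem {u v c N : ℤ} {t : ZMod 3} (h : u ^ 2 + 6 * v ^ 2 = c) (hu : (u : ZMod 3) = 1)
    {z : ℤ × ℤ} (hz : z ∈ formSols N (t + v)) : formMul u v z ∈ formSols (c * N) t := by
  obtain ⟨h1, h2, h3⟩ := hz
  refine ⟨?_, ?_, ?_⟩
  · rw [← h, ← h1]
    simp only [formMul]
    ring
  all_goals
    simp only [formMul]
    push_cast
    rw [h2, h3, hu]
    have h30 : (3 : ZMod 3) = 0 := rfl
  · linear_combination (-(t + v) * v) * h30
  · linear_combination v * h30

/-- The solutions of `2 x ^ 2 + 3 y ^ 2 = p ^ 2 N` are obtained from those of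
`2 x ^ 2 + 3 y ^ 2 = N` by multiplication by elements of norm `p ^ 2`. -/
theorem mem_image_formMul_of_dvd {p u v N : ℤ} {t : ZMod 3} (hp : p ≠ 0)
    (h : u ^ 2 + 6 * v ^ 2 = p ^ 2) (hu : (u : ZMod 3) = 1) (hp3 : (p : ZMod 3) ^ 2 = 1)
    {z : ℤ × ℤ} (hz : z ∈ formSols (p ^ 2 * N) t)
    (h1 : p ^ 2 ∣ z.1 * u + 3 * z.2 * v) (h2 : p ^ 2 ∣ z.2 * u - 2 * z.1 * v) :
    z ∈ formMul u v '' formSols N (t + v) := by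
  obtain ⟨x, y⟩ := z
  obtain ⟨a, ha⟩ := h1
  obtain ⟨b, hb⟩ := h2
  obtain ⟨hz1, hz2, hz3⟩ := hz
  simp only at ha hb hz1 hz2 hz3
  have hpp : p ^ 2 ≠ 0 := pow_ne_zero 2 hp
  have hx : a * u - 3 * b * v = x := by
    apply mul_left_cancel₀ hpp
    linear_combination -u * ha + 3 * v * hb + x * h
  have hy : b * u + 2 * a * v = y := by
    apply mul_left_cancel₀ hpp
    linear_combination -u * hb - 2 * v * ha + y * h
  refine ⟨(a, b), ⟨?_, ?_, ?_⟩, by simp [formMul, hx, hy]⟩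
  · apply mul_left_cancel₀ hpp
    rw [← hz1, ← hx, ← hy, ← h]
    ring
  all_goals
    have ha' := congrArg (Int.cast : ℤ → ZMod 3) ha
    have hb' := congrArg (Int.cast : ℤ → ZMod 3) hb
    push_cast at ha' hb'
    rw [hz2, hz3, hu, hp3] at ha' hb'
    simp only
    have h30 : (3 : ZMod 3) = 0 := rfl
  · linear_combination -ha' + t * v * h30
  · linear_combination -hb' - v * h30

section

variable {p : ℕ} {u v : ℤ}

theorem not_dvd_snd_of_sq_add_six_mul_sq (h : u ^ 2 + 6 * v ^ 2 = (p : ℤ) ^ 2)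
    (hv : v ≠ 0) : ¬ (p : ℤ) ∣ v := by
  intro hd
  have h1 : 0 < v ^ 2 := by positivity
  have h2 : (p : ℤ) ^ 2 ≤ v ^ 2 := Int.le_of_dvd h1 (pow_dvd_pow_of_dvd hd 2)
  nlinarith [sq_nonneg u]

theorem prime_int_not_dvd (hp5 : 5 ≤ p) {c : ℤ} (h1 : 0 < c) (h2 : c < 5) :
    ¬ (p : ℤ) ∣ c := fun h => by
  have := Int.le_of_dvd h1 h
  omega

theorem not_dvd_fst_of_sq_add_six_mul_sq (hp : p.Prime) (hp5 : 5 ≤ p)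
    (h : u ^ 2 + 6 * v ^ 2 = (p : ℤ) ^ 2) (hv : v ≠ 0) : ¬ (p : ℤ) ∣ u := by
  have hpi : Prime (p : ℤ) := Nat.prime_iff_prime_int.mp hp
  intro hd
  have h6 : (p : ℤ) ∣ 2 * (3 * v ^ 2) := by
    have h1 : (p : ℤ) ∣ (p : ℤ) ^ 2 - u ^ 2 := dvd_sub (dvd_pow_self _ two_ne_zero)
      (dvd_pow hd two_ne_zero)
    rwa [← h, show u ^ 2 + 6 * v ^ 2 - u ^ 2 = 2 * (3 * v ^ 2) by ring] at h1
  have := (hpi.dvd_or_dvd h6).resolve_left (prime_int_not_dvd hp5 (by norm_num) (by norm_num))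
  have := (hpi.dvd_or_dvd this).resolve_left (prime_int_not_dvd hp5 (by norm_num) (by norm_num))
  exact not_dvd_snd_of_sq_add_six_mul_sq h hv (hpi.dvd_of_dvd_pow this)

theorem prime_sq_cast_three (hp : p.Prime) (hp5 : 5 ≤ p) : (p : ZMod 3) ^ 2 = 1 := by
  have hp3 : (p : ZMod 3) ≠ 0 := by
    rw [Ne, ZMod.natCast_eq_zero_iff, Nat.prime_dvd_prime_iff_eq Nat.prime_three hp]
    omega
  generalize (p : ZMod 3) = p' at *
  revert p'
  decide

/-- If `p` divides the norm of `2 x + y √-6` and one of `x`, `y`, it divides the other. -/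
theorem dvd_snd_of_dvd_fst (hp : p.Prime) (hp5 : 5 ≤ p) {x y : ℤ} {k : ℕ}
    (h : (p : ℤ) ^ (2 * k) ∣ 2 * x ^ 2 + 3 * y ^ 2) (hx : (p : ℤ) ^ k ∣ x) : (p : ℤ) ^ k ∣ y := by
  have hpi : Prime (p : ℤ) := Nat.prime_iff_prime_int.mp hp
  have h1 : (p : ℤ) ^ (2 * k) ∣ 3 * y ^ 2 := by
    have h2 : (p : ℤ) ^ (2 * k) ∣ x ^ 2 := by
      rw [mul_comm, pow_mul]
      exact pow_dvd_pow_of_dvd hx 2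
    exact (dvd_add_right (h2.mul_left 2)).mp h
  have h3 : (p : ℤ) ^ (2 * k) ∣ y ^ 2 :=
    hpi.pow_dvd_of_dvd_mul_left _ (prime_int_not_dvd hp5 (by norm_num) (by norm_num)) h1
  rwa [mul_comm, pow_mul, Int.pow_dvd_pow_iff two_ne_zero] at h3

/-- A solution of `2 x ^ 2 + 3 y ^ 2 = p ^ 2 N` is divisible by `p`, or comes from one of the
elements `u ± v √-6` of norm `p ^ 2`. -/
theorem formSols_cases (hp : p.Prime) (hp5 : 5 ≤ p) (h : u ^ 2 + 6 * v ^ 2 = (p : ℤ) ^ 2)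
    (hv : v ≠ 0) (hu : (u : ZMod 3) = 1) {N : ℤ} {t : ZMod 3} {z : ℤ × ℤ}
    (hz : z ∈ formSols ((p : ℤ) ^ 2 * N) t) :
    ((p : ℤ) ∣ z.1 ∧ (p : ℤ) ∣ z.2) ∨ z ∈ formMul u v '' formSols N (t + v) ∨
      z ∈ formMul u (-v) '' formSols N (t - v) := by
  have hpi : Prime (p : ℤ) := Nat.prime_iff_prime_int.mp hp
  have hp0 : (p : ℤ) ≠ 0 := hpi.ne_zero
  have hp3 : ((p : ℤ) : ZMod 3) ^ 2 = 1 := by simpa using prime_sq_cast_three hp hp5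
  obtain ⟨x, y⟩ := z
  have hz1 : 2 * x ^ 2 + 3 * y ^ 2 = (p : ℤ) ^ 2 * N := hz.1
  by_cases hx : (p : ℤ) ∣ x
  · refine .inl ⟨hx, ?_⟩
    simpa using dvd_snd_of_dvd_fst hp hp5 (k := 1) (x := x) (y := y)
      (by rw [hz1]; exact dvd_mul_right _ _) (by simpa using hx)
  right
  have hmul : (p : ℤ) ^ 2 ∣ (x * u + 3 * y * v) * (x * u - 3 * y * v) :=
    ⟨x ^ 2 - 3 * v ^ 2 * N, by linear_combination x ^ 2 * h - 3 * v ^ 2 * hz1⟩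
  have hn1 : (p : ℤ) ^ (2 * 2) ∣ 2 * (x * u + 3 * y * v) ^ 2 + 3 * (y * u - 2 * x * v) ^ 2 :=
    ⟨N, by linear_combination (u ^ 2 + 6 * v ^ 2) * hz1 + (p : ℤ) ^ 2 * N * h⟩
  have hn2 : (p : ℤ) ^ (2 * 2) ∣ 2 * (x * u - 3 * y * v) ^ 2 + 3 * (y * u + 2 * x * v) ^ 2 :=
    ⟨N, by linear_combination (u ^ 2 + 6 * v ^ 2) * hz1 + (p : ℤ) ^ 2 * N * h⟩
  by_cases hd : (p : ℤ) ∣ x * u + 3 * y * v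
  · have hd' : ¬ (p : ℤ) ∣ x * u - 3 * y * v := by
      intro hd'
      have h2 : (p : ℤ) ∣ 2 * (x * u) := by
        have h3 := dvd_add hd hd'
        rwa [show x * u + 3 * y * v + (x * u - 3 * y * v) = 2 * (x * u) by ring] at h3
      rcases hpi.dvd_or_dvd h2 with h2 | h2
      · exact prime_int_not_dvd hp5 (by norm_num) (by norm_num) h2
      · rcases hpi.dvd_or_dvd h2 with h2 | h2
        · exact hx h2
        · exact not_dvd_fst_of_sq_add_six_mul_sq hp hp5 h hv h2
    have h1 := hpi.pow_dvd_of_dvd_mul_right 2 hd' hmul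
    exact .inl (mem_image_formMul_of_dvd hp0 h hu hp3 hz h1 (dvd_snd_of_dvd_fst hp hp5 hn1 h1))
  · right
    have h1 := hpi.pow_dvd_of_dvd_mul_left 2 hd hmul
    have h2 := dvd_snd_of_dvd_fst hp hp5 hn2 h1
    have := mem_image_formMul_of_dvd (v := -v) hp0 (by simpa using h) hu hp3 hz
      (by simpa [sub_eq_add_neg] using h1) (by simpa using h2)
    simpa [sub_eq_add_neg] using this

/-- If moreover `p ∣ N`, then the first alternative in `formSols_cases` is superfluous. -/
theorem formSols_eq_union (hp : p.Prime) (hp5 : 5 ≤ p) (h : u ^ 2 + 6 * v ^ 2 = (p : ℤ) ^ 2)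
    (hv : v ≠ 0) (hu : (u : ZMod 3) = 1) {N : ℤ} (hN : (p : ℤ) ∣ N) (t : ZMod 3) :
    formSols ((p : ℤ) ^ 2 * N) t =
      formMul u v '' formSols N (t + v) ∪ formMul u (-v) '' formSols N (t - v) := by
  have hpi : Prime (p : ℤ) := Nat.prime_iff_prime_int.mp hp
  have hp0 : (p : ℤ) ≠ 0 := hpi.ne_zero
  have hp3 : ((p : ℤ) : ZMod 3) ^ 2 = 1 := by simpa using prime_sq_cast_three hp hp5
  apply Set.Subset.antisymm
  · intro z hz
    rcases formSols_cases hp hp5 h hv hu hz with ⟨⟨x, hx⟩, ⟨y, hy⟩⟩ | h'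
    · have hz1 := hz.1
      rw [hx, hy] at hz1
      have hxy : 2 * x ^ 2 + 3 * y ^ 2 = N := by
        apply mul_left_cancel₀ (pow_ne_zero 2 hp0)
        linear_combination hz1
      have hmul : (p : ℤ) ∣ (x * u + 3 * y * v) * (x * u - 3 * y * v) := by
        have : (x * u + 3 * y * v) * (x * u - 3 * y * v) = p * (p * x ^ 2) - N * (3 * v ^ 2) := by
          linear_combination x ^ 2 * h - 3 * v ^ 2 * hxy
        rw [this]
        exact dvd_sub (dvd_mul_right _ _) (hN.mul_right _)
      have hn1 : (p : ℤ) ^ (2 * 1) ∣ 2 * (x * u + 3 * y * v) ^ 2 + 3 * (y * u - 2 * x * v) ^ 2 :=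
        ⟨N, by linear_combination (u ^ 2 + 6 * v ^ 2) * hxy + N * h⟩
      have hn2 : (p : ℤ) ^ (2 * 1) ∣ 2 * (x * u - 3 * y * v) ^ 2 + 3 * (y * u + 2 * x * v) ^ 2 :=
        ⟨N, by linear_combination (u ^ 2 + 6 * v ^ 2) * hxy + N * h⟩
      rcases hpi.dvd_or_dvd hmul with hd | hd
      · have hd2 := dvd_snd_of_dvd_fst hp hp5 hn1 (by simpa using hd)
        refine .inl (mem_image_formMul_of_dvd hp0 h hu hp3 hz ?_ ?_)
        · obtain ⟨c, hc⟩ := hd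
          exact ⟨c, by rw [hx, hy]; linear_combination (p : ℤ) * hc⟩
        · obtain ⟨c, hc⟩ := hd2
          exact ⟨c, by rw [hx, hy]; linear_combination (p : ℤ) * hc⟩
      · have hd2 := dvd_snd_of_dvd_fst hp hp5 hn2 (by simpa using hd)
        right
        rw [sub_eq_add_neg, ← Int.cast_neg]
        refine mem_image_formMul_of_dvd hp0 (by simpa using h) hu hp3 hz ?_ ?_
        · obtain ⟨c, hc⟩ := hd
          exact ⟨c, by rw [hx, hy]; linear_combination (p : ℤ) * hc⟩
        · obtain ⟨c, hc⟩ := hd2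
          exact ⟨c, by rw [hx, hy]; linear_combination (p : ℤ) * hc⟩
    · exact h'
  · rintro _ (⟨z, hz, rfl⟩ | ⟨z, hz, rfl⟩)
    · exact formMul_mem h hu hz
    · exact formMul_mem (by simpa using h) hu (by simpa [sub_eq_add_neg] using hz)

/-- The solutions that arise from both `u + v √-6` and `u - v √-6` are the multiples of `p ^ 2`. -/
theorem mem_inter_image_formMul (hp : p.Prime) (hp5 : 5 ≤ p) (h : u ^ 2 + 6 * v ^ 2 = (p : ℤ) ^ 2)
    (hv : v ≠ 0) {N : ℤ} {t : ZMod 3} {z : ℤ × ℤ}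
    (hz : z ∈ formMul u v '' formSols N (t + v) ∩ formMul u (-v) '' formSols N (t - v)) :
    (p : ℤ) ^ 2 ∣ z.1 ∧ (p : ℤ) ^ 2 ∣ z.2 := by
  have hpi : Prime (p : ℤ) := Nat.prime_iff_prime_int.mp hp
  obtain ⟨⟨⟨a, b⟩, -, rfl⟩, ⟨⟨a', b'⟩, -, h'⟩⟩ := hz
  simp only [formMul, Prod.mk.injEq] at h' ⊢
  set x := a * u - 3 * b * v with hx
  set y := b * u + 2 * a * v with hy
  have h1 : x * u + 3 * y * v = p ^ 2 * a := by rw [hx, hy]; linear_combination a * h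
  have h2 : x * u - 3 * y * v = p ^ 2 * a' := by
    rw [← h'.1, ← h'.2]; linear_combination a' * h
  constructor
  · have h3 : (p : ℤ) ^ 2 ∣ 2 * (u * x) := ⟨a + a', by linear_combination h1 + h2⟩
    exact hpi.pow_dvd_of_dvd_mul_left _ (not_dvd_fst_of_sq_add_six_mul_sq hp hp5 h hv)
      (hpi.pow_dvd_of_dvd_mul_left _ (prime_int_not_dvd hp5 (by norm_num) (by norm_num)) h3)
  · have h3 : (p : ℤ) ^ 2 ∣ 2 * (3 * (v * y)) := ⟨a - a', by linear_combination h1 - h2⟩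
    exact hpi.pow_dvd_of_dvd_mul_left _ (not_dvd_snd_of_sq_add_six_mul_sq h hv)
      (hpi.pow_dvd_of_dvd_mul_left _ (prime_int_not_dvd hp5 (by norm_num) (by norm_num))
      (hpi.pow_dvd_of_dvd_mul_left _ (prime_int_not_dvd hp5 (by norm_num) (by norm_num)) h3))

theorem ncard_formSols_of_sq_not_dvd (hp : p.Prime) (hp5 : 5 ≤ p)
    (h : u ^ 2 + 6 * v ^ 2 = (p : ℤ) ^ 2) (hv : v ≠ 0) (hu : (u : ZMod 3) = 1) {N : ℤ}
    (hN : (p : ℤ) ∣ N) (hN2 : ¬ (p : ℤ) ^ 2 ∣ N) (t : ZMod 3) :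
    (formSols ((p : ℤ) ^ 2 * N) t).ncard =
      (formSols N (t + v)).ncard + (formSols N (t - v)).ncard := by
  have hp0 : (p : ℤ) ^ 2 ≠ 0 := by simp [hp.ne_zero]
  rw [formSols_eq_union hp hp5 h hv hu hN, Set.ncard_union_eq _ ((finite_formSols _ _).image _)
    ((finite_formSols _ _).image _), Set.ncard_image_of_injective _ (formMul_injective hp0 h),
    Set.ncard_image_of_injective _ (formMul_injective hp0 (by simpa using h))]
  rw [Set.disjoint_iff]
  intro z hz
  obtain ⟨⟨x, hx⟩, ⟨y, hy⟩⟩ := mem_inter_image_formMul hp hp5 h hv hz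
  obtain ⟨w, hw, rfl⟩ := hz.1
  have := (formMul_mem h hu hw).1
  rw [hx, hy] at this
  refine hN2 ⟨2 * x ^ 2 + 3 * y ^ 2, ?_⟩
  apply mul_left_cancel₀ hp0
  linear_combination -this

theorem ncard_formSols_add (hp : p.Prime) (hp5 : 5 ≤ p)
    (h : u ^ 2 + 6 * v ^ 2 = (p : ℤ) ^ 2) (hv : v ≠ 0) (hu : (u : ZMod 3) = 1) {N : ℤ}
    (hN : (p : ℤ) ∣ N) (t : ZMod 3) :
    (formSols ((p : ℤ) ^ 2 * ((p : ℤ) ^ 2 * N)) t).ncard + (formSols N t).ncard =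
      (formSols ((p : ℤ) ^ 2 * N) (t + v)).ncard + (formSols ((p : ℤ) ^ 2 * N) (t - v)).ncard := by
  have hp0 : (p : ℤ) ^ 2 ≠ 0 := by simp [hp.ne_zero]
  have hp3 := prime_sq_cast_three hp hp5
  have hinj : Function.Injective (fun z : ℤ × ℤ => ((p : ℤ) ^ 2 * z.1, (p : ℤ) ^ 2 * z.2)) := by
    rintro ⟨x, y⟩ ⟨x', y'⟩ hz
    simpa [hp.ne_zero] using hz
  have hint : formMul u v '' formSols ((p : ℤ) ^ 2 * N) (t + v) ∩
      formMul u (-v) '' formSols ((p : ℤ) ^ 2 * N) (t - v) =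
      (fun z : ℤ × ℤ => ((p : ℤ) ^ 2 * z.1, (p : ℤ) ^ 2 * z.2)) '' formSols N t := by
    apply Set.Subset.antisymm
    · intro z hz
      obtain ⟨⟨x, hx⟩, ⟨y, hy⟩⟩ := mem_inter_image_formMul hp hp5 h hv hz
      obtain ⟨w, hw, rfl⟩ := hz.1
      obtain ⟨h1, h2, h3⟩ := formMul_mem h hu hw
      refine ⟨(x, y), ⟨?_, ?_, ?_⟩, by ext <;> simp [hx, hy]⟩
      · rw [hx, hy] at h1
        apply mul_left_cancel₀ hp0
        apply mul_left_cancel₀ hp0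
        linear_combination h1
      · rw [hx] at h2
        simpa [hp3] using h2
      · rw [hy] at h3
        simpa [hp3] using h3
    · rintro _ ⟨⟨x, y⟩, hz, rfl⟩
      have hz' : (x, y) ∈ formSols N (t + v + (-v : ℤ)) := by simpa using hz
      have hz'' : (x, y) ∈ formSols N (t + (-v : ℤ) + v) := by simpa using hz
      refine ⟨⟨_, formMul_mem (by simpa using h) hu hz', ?_⟩,
        ⟨formMul u v (x, y), by simpa [sub_eq_add_neg] using formMul_mem h hu hz'', ?_⟩⟩
      all_goals
        simp only [formMul, Prod.mk.injEq]
        constructor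
        · linear_combination x * h
        · linear_combination y * h
  rw [formSols_eq_union hp hp5 h hv hu (hN.mul_left _),
    ← Set.ncard_image_of_injective (formSols N t) hinj, ← hint,
    Set.ncard_union_add_ncard_inter _ _ ((finite_formSols _ _).image _)
    ((finite_formSols _ _).image _), Set.ncard_image_of_injective _ (formMul_injective hp0 h),
    Set.ncard_image_of_injective _ (formMul_injective hp0 (by simpa using h))]

theorem even_ncard_formSols_of_norm (hp : p.Prime) (hp5 : 5 ≤ p)
    (h : u ^ 2 + 6 * v ^ 2 = (p : ℤ) ^ 2) (hv : (v : ZMod 3) ≠ 0) (hu : (u : ZMod 3) = 1) {M : ℤ}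
    (hM : ¬ (p : ℤ) ∣ M) (hM2 : Odd M) (k : ℕ) :
    Even (formSols ((p : ℤ) ^ (6 * k + 5) * M) 1).ncard := by
  have hv0 : v ≠ 0 := by
    rintro rfl
    simp at hv
  have hpi : Prime (p : ℤ) := Nat.prime_iff_prime_int.mp hp
  have hp2 : Odd (p : ℤ) := by
    exact_mod_cast hp.odd_of_ne_two (by omega)
  set b : ℕ → ZMod 3 → ℕ := fun j t => (formSols ((p : ℤ) ^ (2 * j + 1) * M) t).ncard with hb
  have hb0 (j) : Even (b j 0) := even_ncard_formSols_zero (hp2.pow.mul hM2)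
  have hsum (j) : b j (1 + v) + b j (1 - v) = b j 0 + b j 1 := by
    have hneg : b j (-1) = b j 1 := ncard_formSols_neg _ _
    have hv' : (v : ZMod 3) = 1 ∨ (v : ZMod 3) = -1 := by
      generalize (v : ZMod 3) = v' at *
      revert v'
      decide
    rcases hv' with hv' | hv' <;> rw [hv', ← hneg]
    · exact add_comm _ _
    · rfl
  have h1 : b 1 1 = b 0 0 + b 0 1 := by
    rw [← hsum, hb]
    simp only
    rw [show (p : ℤ) ^ (2 * 1 + 1) * M = p ^ 2 * (p ^ (2 * 0 + 1) * M) by ring]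
    refine ncard_formSols_of_sq_not_dvd hp hp5 h hv0 hu ?_ ?_ 1
    · exact ⟨M, by ring⟩
    · rw [show (p : ℤ) ^ (2 * 0 + 1) * M = p * M by ring, pow_two,
        mul_dvd_mul_iff_left hpi.ne_zero]
      exact hM
  have hs (j) : b (j + 2) 1 + b j 1 = b (j + 1) 0 + b (j + 1) 1 := by
    rw [← hsum, hb]
    simp only
    rw [show (p : ℤ) ^ (2 * (j + 2) + 1) * M = p ^ 2 * (p ^ 2 * (p ^ (2 * j + 1) * M)) by ring,
      show (p : ℤ) ^ (2 * (j + 1) + 1) * M = p ^ 2 * (p ^ (2 * j + 1) * M) by ring]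
    exact ncard_formSols_add hp hp5 h hv0 hu ((dvd_pow_self _ (by omega)).mul_right _) 1
  have key : Even (b (3 * k + 2) 1) := by
    induction k with
    | zero =>
      have := hs 0
      have := hb0 0
      have := hb0 1
      grind
    | succ k ih =>
      have := hs (3 * k + 2)
      have := hs (3 * k + 3)
      have := hb0 (3 * k + 3)
      have := hb0 (3 * k + 4)
      rw [show 3 * (k + 1) + 2 = 3 * k + 3 + 2 by ring]
      grind
  have he : 6 * k + 5 = 2 * (3 * k + 2) + 1 := by ring
  rw [he]
  exact key

/-- If a number that `p` divides exactly to an odd power is represented by the form, then `-6` is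
a square modulo `p`. -/
theorem exists_dvd_sq_add_six (hp : p.Prime) (hp5 : 5 ≤ p) {M : ℤ} (hM : ¬ (p : ℤ) ∣ M) (j : ℕ)
    {x y : ℤ} (hxy : 2 * x ^ 2 + 3 * y ^ 2 = (p : ℤ) ^ (2 * j + 1) * M) :
    ∃ r : ℤ, (p : ℤ) ∣ r ^ 2 + 6 := by
  have hpi : Prime (p : ℤ) := Nat.prime_iff_prime_int.mp hp
  induction j generalizing x y with
  | zero =>
    by_cases hx : (p : ℤ) ∣ x
    · obtain ⟨b, rfl⟩ : (p : ℤ) ∣ y := by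
        have h1 : (p : ℤ) ∣ 3 * y ^ 2 := by
          rw [← dvd_add_right ((dvd_pow hx two_ne_zero).mul_left 2), hxy]
          exact ⟨M, by ring⟩
        exact hpi.dvd_of_dvd_pow ((hpi.dvd_or_dvd h1).resolve_left
          (prime_int_not_dvd hp5 (by norm_num) (by norm_num)))
      obtain ⟨a, rfl⟩ := hx
      refine absurd ⟨2 * a ^ 2 + 3 * b ^ 2, ?_⟩ hM
      apply mul_left_cancel₀ hpi.ne_zero
      linear_combination -hxy
    · obtain ⟨c, d, hcd⟩ := (hpi.coprime_iff_not_dvd).mpr hx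
      refine ⟨3 * y * d, 3 * d ^ 2 * M + 6 * c * (1 + d * x), ?_⟩
      linear_combination 3 * d ^ 2 * hxy - 6 * (1 + d * x) * hcd
  | succ j ih =>
    by_cases hx : (p : ℤ) ∣ x
    · obtain ⟨b, rfl⟩ : (p : ℤ) ∣ y := by
        have h1 : (p : ℤ) ∣ 3 * y ^ 2 := by
          rw [← dvd_add_right ((dvd_pow hx two_ne_zero).mul_left 2), hxy]
          exact ⟨p ^ (2 * j + 2) * M, by ring⟩
        exact hpi.dvd_of_dvd_pow ((hpi.dvd_or_dvd h1).resolve_left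
          (prime_int_not_dvd hp5 (by norm_num) (by norm_num)))
      obtain ⟨a, rfl⟩ := hx
      refine ih (x := a) (y := b) ?_
      apply mul_left_cancel₀ (pow_ne_zero 2 hpi.ne_zero)
      linear_combination hxy
    · obtain ⟨c, d, hcd⟩ := (hpi.coprime_iff_not_dvd).mpr hx
      refine ⟨3 * y * d, 3 * d ^ 2 * (p ^ (2 * j + 2) * M) + 6 * c * (1 + d * x), ?_⟩
      linear_combination 3 * d ^ 2 * hxy - 6 * (1 + d * x) * hcd

theorem eq_of_mem_formSols_five {z : ℤ × ℤ} (hz : z ∈ formSols 5 1) : z = (1, 1) := by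
  obtain ⟨x, y⟩ := z
  obtain ⟨h1, h2, h3⟩ := hz
  simp only at h1 h2 h3
  have hx : x < 2 := by nlinarith
  have hx' : -2 < x := by nlinarith
  have hy : y < 2 := by nlinarith
  have hy' : -2 < y := by nlinarith
  interval_cases x <;> interval_cases y <;> revert h1 h2 h3 <;> decide

theorem odd_ncard_formSols_five_mul (hp : p.Prime) (hp5 : 5 ≤ p)
    (h : u ^ 2 + 6 * v ^ 2 = (p : ℤ) ^ 2) (hv0 : v ≠ 0) (hv : (v : ZMod 3) = 0)
    (hu : (u : ZMod 3) = 1) : Odd (formSols ((p : ℤ) ^ 2 * 5) 1).ncard := by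
  have hp0 : (p : ℤ) ≠ 0 := by exact_mod_cast hp.ne_zero
  have hp3 := prime_sq_cast_three hp hp5
  obtain ⟨e, he, hep⟩ : ∃ e : ℤ, e ^ 2 = 1 ∧ ((e * p : ℤ) : ZMod 3) = 1 := by
    have : (p : ZMod 3) = 1 ∨ (p : ZMod 3) = -1 := by
      generalize (p : ZMod 3) = p' at *
      revert p'
      decide
    rcases this with h | h
    · exact ⟨1, by norm_num, by simp [h]⟩
    · exact ⟨-1, by norm_num, by simp [h]⟩
  have hone : ((1, 1) : ℤ × ℤ) ∈ formSols 5 1 := ⟨by norm_num, by simp, by simp⟩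
  have h3 : (formSols ((p : ℤ) ^ 2 * 5) 1).ncard = 3 := by
    rw [Set.ncard_eq_three]
    refine ⟨formMul u v (1, 1), formMul u (-v) (1, 1), (e * p, e * p), ?_, ?_, ?_, ?_⟩
    · simp only [formMul, Ne, Prod.mk.injEq]
      omega
    · simp only [formMul, Ne, Prod.mk.injEq]
      omega
    · simp only [formMul, Ne, Prod.mk.injEq]
      omega
    · apply Set.Subset.antisymm
      · intro z hz
        rcases formSols_cases hp hp5 h hv0 hu hz with
          ⟨⟨x, hx⟩, ⟨y, hy⟩⟩ | ⟨w, hw, rfl⟩ | ⟨w, hw, rfl⟩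
        · obtain ⟨h1, h2, h3⟩ := hz
          have hxy : 2 * x ^ 2 + 3 * y ^ 2 = 5 := by
            apply mul_left_cancel₀ (pow_ne_zero 2 hp0)
            rw [← h1, hx, hy]
            ring
          have hex : e * x = 1 ∧ e * y = 1 := by
            have := eq_of_mem_formSols_five (z := (e * x, e * y)) ⟨?_, ?_, ?_⟩
            · simpa using this
            · linear_combination (2 * x ^ 2 + 3 * y ^ 2) * he + hxy
            · rw [hx] at h2
              push_cast at h2 hep ⊢
              linear_combination (p * x : ZMod 3) * hep + h2 - (e * x : ZMod 3) * hp3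
            · rw [hy] at h3
              push_cast at h3 hep ⊢
              linear_combination (p * y : ZMod 3) * hep + h3 - (e * y : ZMod 3) * hp3
          have hxe : x = e := by linear_combination e * hex.1 - x * he
          have hye : y = e := by linear_combination e * hex.2 - y * he
          right; right
          ext
          · simp [hx, hxe, mul_comm]
          · simp [hy, hye, mul_comm]
        · rw [hv, add_zero] at hw
          rw [eq_of_mem_formSols_five hw]
          simp
        · rw [hv, sub_zero] at hw
          rw [eq_of_mem_formSols_five hw]
          simp
      · rintro z (rfl | rfl | rfl)
        · exact formMul_mem h hu (by simpa [hv] using hone)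
        · exact formMul_mem (by simpa using h) hu (by simpa [hv] using hone)
        · exact ⟨by linear_combination 5 * (p : ℤ) ^ 2 * he, hep, hep⟩
  rw [h3]
  decide

end

theorem even_ncard_formSols {p : ℕ} (hp : p.Prime) (hp5 : 5 ≤ p)
    (hw : p ≠ 5 → Even (formSols ((p : ℤ) ^ 2 * 5) 1).ncard) {M : ℤ}
    (hM : ¬ (p : ℤ) ∣ M) (hM2 : Odd M) (k : ℕ) :
    Even (formSols ((p : ℤ) ^ (6 * k + 5) * M) 1).ncard := by
  rcases (formSols ((p : ℤ) ^ (6 * k + 5) * M) 1).eq_empty_or_nonempty with h0 | ⟨z, hz⟩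
  · simp [h0]
  obtain ⟨r, hr⟩ := exists_dvd_sq_add_six hp hp5 hM (3 * k + 2)
    (by rw [show 2 * (3 * k + 2) + 1 = 6 * k + 5 by ring]; exact hz.1)
  obtain ⟨u, v, h, hv, hu⟩ := exists_sq_add_six_mul_sq_eq_prime_sq hp hp5 hr
  refine even_ncard_formSols_of_norm hp hp5 h (fun hv3 => ?_) hu hM hM2 k
  by_cases h5 : p = 5
  · subst h5
    push_cast at h
    have h1 : v < 3 := by nlinarith
    have h2 : -3 < v := by nlinarith
    obtain ⟨c, rfl⟩ := (ZMod.intCast_zmod_eq_zero_iff_dvd v 3).mp hv3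
    omega
  · exact Nat.not_even_iff_odd.mpr (odd_ncard_formSols_five_mul hp hp5 h hv hv3 hu) (hw h5)

open PowerSeries PowerSeries.WithPiTopology in
theorem hasProd_expand_pentagonalSeries (R : Type*) [CommRing R] [TopologicalSpace R] {m : ℕ}
    (hm : m ≠ 0) :
    HasProd (fun i : ℕ => (1 - X ^ ((i + 1) * m) : R⟦X⟧)) (expand m hm (pentagonalSeries R)) := by
  rw [HasProd, tendsto_iff_coeff_tendsto]
  intro d
  have h (s : Finset ℕ) : ∏ i ∈ s, (1 - X ^ ((i + 1) * m) : R⟦X⟧) =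
      expand m hm (∏ i ∈ s, (1 - X ^ (i + 1))) := by
    simp [map_prod, ← pow_mul, mul_comm]
  simp only [h, coeff_expand]
  split_ifs
  · exact ((tendsto_iff_coeff_tendsto R _ _ _).mp (hasProd_one_sub_X_pow R)) _
  · exact tendsto_const_nhds

open PowerSeries PowerSeries.WithPiTopology in
theorem powerSeriesMk_regularPartitionCount_mul (R : Type*) [CommRing R] [NoZeroDivisors R] {m : ℕ}
    (hm : m ≠ 0) :
    (PowerSeries.mk fun n => (regularPartitionCount m n : R)) * pentagonalSeries R =
      expand m hm (pentagonalSeries R) := by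
  let _ : TopologicalSpace R := ⊥
  have _ : DiscreteTopology R := ⟨rfl⟩
  have h1 (n : ℕ) : regularPartitionCount m n = (Nat.Partition.restricted n (¬ m ∣ ·)).card := by
    rw [regularPartitionCount, Nat.card_eq_fintype_card, Fintype.card_subtype]
    rfl
  simp only [h1]
  rw [Nat.Partition.powerSeriesMk_card_restricted_eq_powerSeriesMk_card_countRestricted R
    (Nat.pos_of_ne_zero hm)]
  refine ((Nat.Partition.hasProd_powerSeriesMk_card_countRestricted R (Nat.pos_of_ne_zero hm)).mul
    (hasProd_one_sub_X_pow R)).unique ?_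
  convert hasProd_expand_pentagonalSeries R hm using 2 with i
  · rfl
  · simp_rw [pow_mul, geom_sum_mul_neg]

open PowerSeries PowerSeries.WithPiTopology in
theorem expand_two_pentagonalSeries :
    expand 2 two_ne_zero (pentagonalSeries (ZMod 2)) = pentagonalSeries (ZMod 2) ^ 2 := by
  let _ : TopologicalSpace (ZMod 2) := ⊥
  have _ : DiscreteTopology (ZMod 2) := ⟨rfl⟩
  refine (hasProd_expand_pentagonalSeries (ZMod 2) two_ne_zero).unique ?_
  rw [pow_two]
  convert (hasProd_one_sub_X_pow (ZMod 2)).mul (hasProd_one_sub_X_pow (ZMod 2)) using 2 with i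
  have h2 : (2 : (ZMod 2)⟦X⟧) = 0 := by
    rw [← map_ofNat (C (R := ZMod 2)) 2, show (OfNat.ofNat 2 : ZMod 2) = 0 from rfl, map_zero]
  rw [pow_mul]
  linear_combination (X ^ (i + 1) - (X ^ (i + 1)) ^ 2) * h2

open PowerSeries in
theorem pentagonalSeries_ne_zero (R : Type*) [CommRing R] [Nontrivial R] :
    pentagonalSeries R ≠ 0 := by
  intro h
  have := coeff_pentagonalSeries_pentagonal R 0
  simp [h] at this

open PowerSeries in
theorem B_four_three_cast (n : ℕ) :
    (B 4 3 n : ZMod 2) = coeff n (expand 2 two_ne_zero (pentagonalSeries (ZMod 2)) *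
      expand 3 three_ne_zero (pentagonalSeries (ZMod 2))) := by
  have h4 := powerSeriesMk_regularPartitionCount_mul (ZMod 2) four_ne_zero
  have h3 := powerSeriesMk_regularPartitionCount_mul (ZMod 2) three_ne_zero
  have h44 : expand 4 four_ne_zero (pentagonalSeries (ZMod 2)) = pentagonalSeries (ZMod 2) ^ 4 := by
    rw [show expand 4 four_ne_zero (pentagonalSeries (ZMod 2)) =
      expand 2 two_ne_zero (expand 2 two_ne_zero (pentagonalSeries (ZMod 2))) from
      expand_mul 2 two_ne_zero 2 two_ne_zero _]
    rw [expand_two_pentagonalSeries, map_pow, expand_two_pentagonalSeries]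
    ring
  have h : (PowerSeries.mk fun n => (regularPartitionCount 4 n : ZMod 2)) *
      (PowerSeries.mk fun n => (regularPartitionCount 3 n : ZMod 2)) =
      expand 2 two_ne_zero (pentagonalSeries (ZMod 2)) *
      expand 3 three_ne_zero (pentagonalSeries (ZMod 2)) := by
    apply mul_right_cancel₀ (pow_ne_zero 2 (pentagonalSeries_ne_zero (ZMod 2)))
    rw [expand_two_pentagonalSeries, ← h3]
    rw [h44] at h4
    linear_combination (PowerSeries.mk fun n => (regularPartitionCount 3 n : ZMod 2)) *
      pentagonalSeries (ZMod 2) * h4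
  rw [← h, coeff_mul, Finset.Nat.sum_antidiagonal_eq_sum_range_succ_mk, B]
  simp

open PowerSeries PowerSeries.WithPiTopology in
theorem a1_cast (n : ℕ) :
    (a1 n : ZMod 2) = coeff n (expand 2 two_ne_zero (pentagonalSeries (ZMod 2)) *
      expand 3 three_ne_zero (pentagonalSeries (ZMod 2))) := by
  let _ : TopologicalSpace (ZMod 2) := ⊥
  have _ : DiscreteTopology (ZMod 2) := ⟨rfl⟩
  have hprod : HasProd (fun i : ℕ => (1 - X ^ (i + 1)) ^ 2 * (1 - X ^ (3 * (i + 1))))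
      (expand 2 two_ne_zero (pentagonalSeries (ZMod 2)) *
      expand 3 three_ne_zero (pentagonalSeries (ZMod 2))) := by
    rw [expand_two_pentagonalSeries, pow_two]
    convert ((hasProd_one_sub_X_pow (ZMod 2)).mul (hasProd_one_sub_X_pow (ZMod 2))).mul
      (hasProd_expand_pentagonalSeries (ZMod 2) three_ne_zero) using 2 with i
    rw [pow_two, mul_comm 3]
  have hlim := ((tendsto_iff_coeff_tendsto _ _ _ _).mp hprod.tendsto_prod_nat) n
  have hstable (N : ℕ) (hN : n ≤ N) :
      coeff n (∏ i ∈ Finset.range N, ((1 - X ^ (i + 1)) ^ 2 * (1 - X ^ (3 * (i + 1))) :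
        (ZMod 2)⟦X⟧)) =
      coeff n (∏ i ∈ Finset.range n, ((1 - X ^ (i + 1)) ^ 2 * (1 - X ^ (3 * (i + 1))))) := by
    induction N, hN using Nat.le_induction with
    | base => rfl
    | succ N hN ih =>
      rw [Finset.prod_range_succ, ← ih]
      set P : (ZMod 2)⟦X⟧ := ∏ i ∈ Finset.range N, ((1 - X ^ (i + 1)) ^ 2 * (1 - X ^ (3 * (i + 1))))
      set T : (ZMod 2)⟦X⟧ := X ^ (N + 1) with hT
      have h3 : (X : (ZMod 2)⟦X⟧) ^ (3 * (N + 1)) = T ^ 3 := by rw [hT, ← pow_mul, mul_comm]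
      rw [h3, show P * ((1 - T) ^ 2 * (1 - T ^ 3)) =
        P + T * (P * ((-2 + T) * (1 - T ^ 3) - T ^ 2)) by ring, map_add, hT,
        coeff_X_pow_mul', if_neg (by omega), add_zero]
  have hev := tendsto_nhds_unique hlim (tendsto_const_nhds.congr'
    ((Filter.eventually_ge_atTop n).mono fun N hN => (hstable N hN).symm))
  let f : Polynomial ℤ →+* (ZMod 2)⟦X⟧ :=
    Polynomial.coeToPowerSeries.ringHom.comp (Polynomial.mapRingHom (Int.castRingHom (ZMod 2)))
  have hf (P : Polynomial ℤ) : (P.coeff n : ZMod 2) = coeff n (f P) := by simp [f]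
  have hIcc : Finset.Icc 1 n = Finset.Ico (0 + 1) (n + 1) := by
    ext
    simp only [Finset.mem_Icc, Finset.mem_Ico]
    omega
  rw [hev, a1, hf, map_prod, hIcc, Finset.range_eq_Ico, ← Finset.prod_Ico_add']
  simp [f]

open PowerSeries in
theorem coeff_expand_pentagonalSeries (m : ℕ) (hm : m ≠ 0) (n : ℕ)
    [Decidable (∃ k, n = m * pentagonal k)] :
    coeff n (expand m hm (pentagonalSeries (ZMod 2))) =
      if ∃ k, n = m * pentagonal k then 1 else 0 := by
  split_ifs with h
  · obtain ⟨k, rfl⟩ := h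
    rw [coeff_expand_mul, coeff_pentagonalSeries_pentagonal]
    rcases Int.units_eq_one_or k.negOnePow with h | h <;> rw [h] <;> rfl
  · rw [coeff_expand]
    split_ifs with hd
    · obtain ⟨j, rfl⟩ := hd
      rw [Nat.mul_div_cancel_left _ (Nat.pos_of_ne_zero hm)]
      refine coeff_pentagonalSeries_eq_zero _ ?_
      rintro ⟨k, rfl⟩
      exact h ⟨k, rfl⟩
    · rfl

open PowerSeries in
theorem coeff_expand_mul_expand_pentagonalSeries (n : ℕ) :
    coeff n (expand 2 two_ne_zero (pentagonalSeries (ZMod 2)) *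
      expand 3 three_ne_zero (pentagonalSeries (ZMod 2))) =
      ((formSols (24 * n + 5) 1).ncard : ZMod 2) := by
  classical
  set K : Set (ℤ × ℤ) := {z | 2 * pentagonal z.1 + 3 * pentagonal z.2 = n} with hK
  have h1 : formSols (24 * n + 5) 1 = (fun z : ℤ × ℤ => (1 - 6 * z.1, 1 - 6 * z.2)) '' K := by
    ext ⟨x, y⟩
    constructor
    · rintro ⟨h1, h2, h3⟩
      simp only at h1 h2 h3
      have hy2 : Odd y := by
        by_contra hy
        obtain ⟨c, rfl⟩ := (Int.not_odd_iff_even.mp hy)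
        ring_nf at h1
        omega
      have hx2 : Odd x := by
        by_contra hx
        obtain ⟨c, rfl⟩ := (Int.not_odd_iff_even.mp hx)
        obtain ⟨m, hm⟩ := Int.eight_dvd_sq_sub_one_of_odd hy2
        have h8 : 8 * c ^ 2 + 3 * (8 * m + 1) = 24 * n + 5 := by linear_combination h1 - 3 * hm
        omega
      have hmod (a : ℤ) (ha : Odd a) (ha3 : (a : ZMod 3) = 1) : ∃ k, a = 1 - 6 * k := by
        have : ((a - 1 : ℤ) : ZMod 3) = 0 := by simp [ha3]
        obtain ⟨c, hc⟩ := (ZMod.intCast_zmod_eq_zero_iff_dvd _ 3).mp this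
        obtain ⟨d, hd⟩ := ha
        push_cast at hc
        exact ⟨c - d, by omega⟩
      obtain ⟨k, rfl⟩ := hmod x hx2 h2
      obtain ⟨l, rfl⟩ := hmod y hy2 h3
      refine ⟨(k, l), ?_, rfl⟩
      have hk := two_mul_natCast_pentagonal k
      have hl := two_mul_natCast_pentagonal l
      simp only [hK, Set.mem_ofPred_eq]
      zify
      linarith
    · rintro ⟨⟨k, l⟩, h, h'⟩
      simp only [hK, Set.mem_ofPred_eq, Prod.mk.injEq] at h h'
      obtain ⟨rfl, rfl⟩ := h'
      have hk := two_mul_natCast_pentagonal k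
      have hl := two_mul_natCast_pentagonal l
      zify at h
      have h6 : (6 : ZMod 3) = 0 := rfl
      exact ⟨by simp only; linarith, by simp [h6], by simp [h6]⟩
  set F : Finset (ℕ × ℕ) := {z ∈ Finset.HasAntidiagonal.antidiagonal n |
    (∃ k, z.1 = 2 * pentagonal k) ∧ ∃ l, z.2 = 3 * pentagonal l} with hF
  have h2 : (F : Set (ℕ × ℕ)) =
      (fun z : ℤ × ℤ => (2 * pentagonal z.1, 3 * pentagonal z.2)) '' K := by
    ext ⟨i, j⟩
    simp only [hF, Finset.coe_filter, Finset.HasAntidiagonal.mem_antidiagonal, Set.mem_ofPred_eq,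
      Set.mem_image, hK, Prod.exists, Prod.mk.injEq]
    constructor
    · rintro ⟨h, ⟨k, rfl⟩, l, rfl⟩
      exact ⟨k, l, h, rfl, rfl⟩
    · rintro ⟨k, l, h, rfl, rfl⟩
      exact ⟨h, ⟨k, rfl⟩, l, rfl⟩
  rw [h1, Set.ncard_image_of_injective, ← Set.ncard_image_of_injective K, ← h2,
    Set.ncard_coe_finset, hF, Finset.card_filter, coeff_mul]
  · push_cast
    refine Finset.sum_congr rfl fun z _ => ?_
    rw [coeff_expand_pentagonalSeries, coeff_expand_pentagonalSeries, ite_zero_mul_ite_zero,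
      mul_one]
  · rintro ⟨k, l⟩ ⟨k', l'⟩ h
    simpa [pentagonal_inj] using h
  · rintro ⟨k, l⟩ ⟨k', l'⟩ h
    simpa using h

theorem prime_sq_mod_twentyfour {p : ℕ} (hp : p.Prime) (hp5 : 5 ≤ p) : p ^ 2 % 24 = 1 := by
  have h2 : p % 2 ≠ 0 := fun h => by
    have := (Nat.prime_dvd_prime_iff_eq Nat.prime_two hp).mp (Nat.dvd_of_mod_eq_zero h)
    omega
  have h3 : p % 3 ≠ 0 := fun h => by
    have := (Nat.prime_dvd_prime_iff_eq Nat.prime_three hp).mp (Nat.dvd_of_mod_eq_zero h)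
    omega
  have h : p % 24 < 24 := Nat.mod_lt _ (by norm_num)
  have h2' : p % 24 % 2 ≠ 0 := by omega
  have h3' : p % 24 % 3 ≠ 0 := by omega
  rw [Nat.pow_mod]
  generalize p % 24 = r at *
  revert r
  decide

theorem twentyfour_mul_add_five {p : ℕ} (hp : p.Prime) (hp5 : 5 ≤ p) (j : ℕ) :
    24 * (5 * (p ^ (2 * j) - 1) / 24) + 5 = p ^ (2 * j) * 5 := by
  have h : p ^ (2 * j) % 24 = 1 := by
    rw [pow_mul, Nat.pow_mod, prime_sq_mod_twentyfour hp hp5, one_pow]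
    rfl
  omega

theorem even_ncard_formSols_prime_sq_mul_five {p : ℕ} (hp : p.Prime) (hp5 : 5 ≤ p)
    (hw : ¬ w1 p hp ≡ 0 [ZMOD 2]) (h5 : p ≠ 5) : Even (formSols ((p : ℤ) ^ 2 * 5) 1).ncard := by
  have : Fact p.Prime := ⟨hp⟩
  have hpi : Prime (p : ℤ) := Nat.prime_iff_prime_int.mp hp
  have h24 := twentyfour_mul_add_five hp hp5 1
  rw [mul_one] at h24
  rw [w1] at hw
  set m := 5 * (p ^ 2 - 1) / 24
  have hz : (24 * m + 5 : ℤ) = (p : ℤ) ^ 2 * 5 := by exact_mod_cast h24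
  have h1 : ((-6 : ℤ) : ZMod p) ≠ 0 := by
    rw [Ne, ZMod.intCast_zmod_eq_zero_iff_dvd, dvd_neg, show (6 : ℤ) = 2 * 3 by norm_num]
    intro h
    rcases hpi.dvd_or_dvd h with h | h
    · exact prime_int_not_dvd hp5 (by norm_num) (by norm_num) h
    · exact prime_int_not_dvd hp5 (by norm_num) (by norm_num) h
  have h2 : ((-(m : ℤ) : ℤ) : ZMod p) ≠ 0 := by
    rw [Ne, ZMod.intCast_zmod_eq_zero_iff_dvd, dvd_neg]
    rintro ⟨c, hc⟩
    have h : (p : ℤ) ∣ (5 : ℕ) := ⟨p * 5 - 24 * c, by push_cast; linear_combination hz - 24 * hc⟩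
    exact h5 ((Nat.prime_dvd_prime_iff_eq hp Nat.prime_five).mp (by exact_mod_cast h))
  have ha : (a1 m : ZMod 2) = 0 := by
    rw [ZMod.intCast_zmod_eq_zero_iff_dvd]
    rw [Int.modEq_zero_iff_dvd] at hw
    rcases legendreSym.eq_one_or_neg_one p h1 with h1 | h1 <;>
    rcases legendreSym.eq_one_or_neg_one p h2 with h2 | h2 <;>
    · rw [h1, h2] at hw
      push_cast
      omega
  rw [a1_cast, coeff_expand_mul_expand_pentagonalSeries, hz,
    ZMod.natCast_eq_zero_iff] at ha
  exact even_iff_two_dvd.mpr ha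

/-- Theorem 1.8(ii). -/
theorem B_4_3_cong_ii (p : ℕ) (hp : p.Prime) (hp5 : 5 ≤ p)
    (hw : ¬ w1 p hp ≡ 0 [ZMOD 2]) (n k : ℕ) (hn : ¬ p ∣ n) :
    B 4 3 (p ^ (6 * k + 5) * n + 5 * (p ^ (6 * k + 6) - 1) / 24) ≡ 0 [MOD 2] := by
  have h24 := twentyfour_mul_add_five hp hp5 (3 * k + 3)
  rw [show 2 * (3 * k + 3) = 6 * k + 6 by ring] at h24
  set m := 5 * (p ^ (6 * k + 6) - 1) / 24
  have hz : (24 * ((p ^ (6 * k + 5) * n + m : ℕ) : ℤ) + 5) =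
      (p : ℤ) ^ (6 * k + 5) * (24 * n + 5 * p) := by
    have h : (24 * m + 5 : ℤ) = (p : ℤ) ^ (6 * k + 6) * 5 := by exact_mod_cast h24
    push_cast
    linear_combination h
  have hpi : Prime (p : ℤ) := Nat.prime_iff_prime_int.mp hp
  have hM : ¬ (p : ℤ) ∣ 24 * n + 5 * p := by
    rw [dvd_add_left (dvd_mul_left _ _), show (24 : ℤ) * n = 2 * (4 * (3 * n)) by ring]
    have h (c : ℤ) (h1 : 0 < c) (h2 : c < 5) := prime_int_not_dvd (p := p) hp5 h1 h2
    rw [hpi.dvd_mul, hpi.dvd_mul, hpi.dvd_mul, Int.natCast_dvd_natCast]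
    simp [h, hn]
  have hM2 : Odd (24 * n + 5 * p : ℤ) := by
    have h2 : Odd p := hp.odd_of_ne_two (by omega)
    obtain ⟨c, hc⟩ := h2
    exact ⟨12 * n + 5 * c + 2, by rw [hc]; push_cast; ring⟩
  have h := even_ncard_formSols hp hp5 (even_ncard_formSols_prime_sq_mul_five hp hp5 hw) hM hM2 k
  rw [← hz, even_iff_two_dvd, ← ZMod.natCast_eq_zero_iff,
    ← coeff_expand_mul_expand_pentagonalSeries, ← B_four_three_cast, ZMod.natCast_eq_zero_iff] at h
  exact (Nat.modEq_zero_iff_dvd).mpr h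
end

section
/- Let p ≥ 5 be a prime number and suppose w_2(p) ≡ 0 (mod 2). Then for all nonnegative integers n and k with p ∤ n, we have B_{8,3}( p^{4k+3} n + 3(p^{4k+4} − 1)/8 ) ≡ 0 (mod 2). -/
/-- `a2 n` is the coefficient of `q^n` in `∏ (1 - q^k)^6 (1 - q^{3k})`. -/
noncomputable def a2 (n : ℕ) : ℤ :=
  (∏ k ∈ Finset.Icc 1 n,
      ((1 - Polynomial.X ^ k) ^ 6 * (1 - Polynomial.X ^ (3 * k)) : Polynomial ℤ)).coeff n

/-- `w2 p = a2(3(p²−1)/8) + p² (−6/p)_L (−3(p²−1)/8 / p)_L` for a prime `p ≥ 5`. -/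
noncomputable def w2 (p : ℕ) (hp : p.Prime) : ℤ :=
  a2 (3 * (p ^ 2 - 1) / 8)
    + (p : ℤ) ^ 2 * @legendreSym p ⟨hp⟩ (-6)
        * @legendreSym p ⟨hp⟩ (-((3 * (p ^ 2 - 1) / 8 : ℕ) : ℤ))


namespace ZsqrtdNegTwo

local notation "R₂" => Zsqrtd (-2)

/-- The elements of `ℤ[√-2]` of norm `N` that are not divisible by `3`. -/
def normSet (N : ℤ) : Set R₂ := {z | z.norm = N ∧ ¬ (3 : R₂) ∣ z}

theorem norm_eq (z : R₂) : z.norm = z.re ^ 2 + 2 * z.im ^ 2 := by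
  rw [Zsqrtd.norm_def]; ring

theorem mul_left_cancel_of_norm_ne_zero {x y z : R₂} (hx : x.norm ≠ 0) (h : x * y = x * z) :
    y = z := by
  have h' : ((x.norm : ℤ) : R₂) * y = (x.norm : ℤ) * z := by
    rw [Zsqrtd.norm_eq_mul_conj, mul_comm x, mul_assoc, h, mul_assoc]
  exact Zsqrtd.eq_of_smul_eq_smul_left hx h'

theorem finite_norm_eq (N : ℤ) : {z : R₂ | z.norm = N}.Finite := by
  have : {z : R₂ | z.norm = N} ⊆ (fun p : ℤ × ℤ => (⟨p.1, p.2⟩ : R₂)) ''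
      ((Set.Icc (-|N|) |N|) ×ˢ (Set.Icc (-|N|) |N|)) := by
    intro z hz
    rw [Set.mem_ofPred_eq, norm_eq] at hz
    have h1 : |z.re| ≤ |N| := by
      apply sq_le_sq.mp
      have : z.re ^ 2 ≤ N := by nlinarith [sq_nonneg z.im]
      have h0 : 0 ≤ z.re ^ 2 := sq_nonneg _
      rcases h0.eq_or_lt with h | h <;> nlinarith
    have h2 : |z.im| ≤ |N| := by
      apply sq_le_sq.mp
      have : z.im ^ 2 ≤ N := by nlinarith [sq_nonneg z.re, sq_nonneg z.im]
      have h0 : 0 ≤ z.im ^ 2 := sq_nonneg _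
      rcases h0.eq_or_lt with h | h <;> nlinarith
    exact ⟨(z.re, z.im), ⟨abs_le.mp h1, abs_le.mp h2⟩, rfl⟩
  exact (((Set.finite_Icc _ _).prod (Set.finite_Icc _ _)).image _).subset this

theorem normSet_finite (N : ℤ) : (normSet N).Finite :=
  (finite_norm_eq N).subset fun _ hz => hz.1

theorem dvd_of_intCast_dvd_star_mul {w z : R₂} (hw : w.norm ≠ 0)
    (h : ((w.norm : ℤ) : R₂) ∣ star w * z) : w ∣ z := by
  obtain ⟨u, hu⟩ := h
  rw [Zsqrtd.norm_eq_mul_conj, mul_comm w, mul_assoc] at hu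
  exact ⟨u, mul_left_cancel_of_norm_ne_zero (by rwa [Zsqrtd.norm_conj]) hu⟩

theorem intCast_dvd_of_dvd_im {q : ℤ} (hq : Prime q) {z : R₂} (hn : q ∣ z.norm)
    (him : q ∣ z.im) : (q : R₂) ∣ z := by
  rw [Zsqrtd.intCast_dvd]
  refine ⟨hq.dvd_of_dvd_pow (n := 2) ?_, him⟩
  rw [norm_eq] at hn
  exact (Int.dvd_add_left ((him.pow (by norm_num)).mul_left 2)).mp hn

theorem dvd_or_star_dvd {w z : R₂} (hw : Prime w.norm) (h : w.norm ∣ z.norm) :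
    w ∣ z ∨ star w ∣ z := by
  have key : w.norm ∣ (star w * z).im * (w * z).im := by
    obtain ⟨m, hm⟩ := h
    refine ⟨z.im ^ 2 - m * w.im ^ 2, ?_⟩
    have hm' := hm
    rw [norm_eq z] at hm'
    simp only [Zsqrtd.im_mul, Zsqrtd.re_star, Zsqrtd.im_star]
    have e := norm_eq w
    linear_combination (-w.im ^ 2) * hm' + (-z.im ^ 2) * e
  rcases hw.dvd_or_dvd key with h' | h'
  · left
    refine dvd_of_intCast_dvd_star_mul hw.ne_zero (intCast_dvd_of_dvd_im hw ?_ h')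
    rw [Zsqrtd.norm_mul]; exact h.mul_left _
  · right
    refine dvd_of_intCast_dvd_star_mul (by rw [Zsqrtd.norm_conj]; exact hw.ne_zero) ?_
    rw [Zsqrtd.norm_conj, star_star]
    refine intCast_dvd_of_dvd_im hw ?_ h'
    rw [Zsqrtd.norm_mul]; exact h.mul_left _

theorem intCast_dvd_of_dvd_of_star_dvd {w z : R₂} (hw : Prime w.norm) (h2 : ¬ w.norm ∣ 2)
    (h : w ∣ z) (h' : star w ∣ z) : ((w.norm : ℤ) : R₂) ∣ z := by
  have hz : w.norm ∣ z.norm := by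
    obtain ⟨u, rfl⟩ := h
    rw [Zsqrtd.norm_mul]; exact dvd_mul_right _ _
  have hre : ¬ w.norm ∣ w.re := by
    intro h0
    have e := norm_eq w
    have h1 : w.norm ∣ 2 * w.im ^ 2 := by
      have : w.norm ∣ w.re ^ 2 + 2 * w.im ^ 2 := by rw [← e]
      exact (Int.dvd_add_right (h0.pow (by norm_num))).mp this
    have h3 := hw.dvd_of_dvd_pow ((hw.dvd_or_dvd h1).resolve_left h2)
    obtain ⟨a, ha⟩ := h0
    obtain ⟨b, hb⟩ := h3
    have : w.norm * 1 = w.norm * (w.norm * (a ^ 2 + 2 * b ^ 2)) := by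
      calc w.norm * 1 = w.re ^ 2 + 2 * w.im ^ 2 := by rw [mul_one, e]
        _ = (w.norm * a) ^ 2 + 2 * (w.norm * b) ^ 2 := by rw [← ha, ← hb]
        _ = _ := by ring
    exact hw.not_dvd_one ⟨_, mul_left_cancel₀ hw.ne_zero this⟩
  have h3 : ((w.norm : ℤ) : R₂) ∣ star w * z := by
    rw [Zsqrtd.norm_eq_mul_conj, mul_comm]; exact mul_dvd_mul_left _ h
  have h4 : ((w.norm : ℤ) : R₂) ∣ w * z := by
    rw [Zsqrtd.norm_eq_mul_conj]; exact mul_dvd_mul_left _ h'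
  have h5 := ((Zsqrtd.intCast_dvd _ _).mp (dvd_add h3 h4)).2
  have h6 : (star w * z + w * z).im = 2 * (w.re * z.im) := by
    simp only [Zsqrtd.im_add, Zsqrtd.im_mul, Zsqrtd.re_star, Zsqrtd.im_star]; ring
  rw [h6] at h5
  exact intCast_dvd_of_dvd_im hw hz
    ((hw.dvd_or_dvd ((hw.dvd_or_dvd h5).resolve_left h2)).resolve_left hre)

theorem three_dvd_mul_iff {w z : R₂} (hw : ¬ 3 ∣ w.norm) : (3 : R₂) ∣ w * z ↔ (3 : R₂) ∣ z := by
  refine ⟨fun h => ?_, fun h => h.mul_left _⟩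
  have h1 : ((3 : ℤ) : R₂) ∣ ((w.norm : ℤ) : R₂) * z := by
    rw [Zsqrtd.norm_eq_mul_conj, mul_comm w, mul_assoc]; exact h.mul_left _
  rw [Zsqrtd.intCast_dvd, Zsqrtd.re_smul, Zsqrtd.im_smul] at h1
  have h3 : ((3 : ℤ) : R₂) ∣ z := (Zsqrtd.intCast_dvd _ _).mpr
    ⟨(Int.prime_three.dvd_or_dvd h1.1).resolve_left hw,
      (Int.prime_three.dvd_or_dvd h1.2).resolve_left hw⟩
  exact_mod_cast h3

theorem injective_mul {w : R₂} (hw : w.norm ≠ 0) : Function.Injective (fun z => w * z) :=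
  fun _ _ h => mul_left_cancel_of_norm_ne_zero hw h

theorem mul_mem_normSet_iff {w z : R₂} (hw : w.norm ≠ 0) (h3 : ¬ 3 ∣ w.norm) {m : ℤ} :
    w * z ∈ normSet (w.norm * m) ↔ z ∈ normSet m := by
  simp only [normSet, Set.mem_ofPred_eq, three_dvd_mul_iff h3, Zsqrtd.norm_mul]
  rw [mul_right_inj' hw]

theorem normSet_mul {w : R₂} (hw : Prime w.norm) (h3 : ¬ 3 ∣ w.norm) (m : ℤ) :
    normSet (w.norm * m) = (fun z => w * z) '' normSet m ∪ (fun z => star w * z) '' normSet m := by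
  have hs : (star w).norm = w.norm := Zsqrtd.norm_conj w
  ext z
  constructor
  · intro hz
    rcases dvd_or_star_dvd hw (z := z) ⟨m, hz.1⟩ with ⟨u, rfl⟩ | ⟨u, rfl⟩
    · exact Or.inl ⟨u, (mul_mem_normSet_iff hw.ne_zero h3).mp hz, rfl⟩
    · refine Or.inr ⟨u, (mul_mem_normSet_iff (w := star w) ?_ ?_).mp ?_, rfl⟩
      · rw [hs]; exact hw.ne_zero
      · rwa [hs]
      · rwa [hs]
  · rintro (⟨u, hu, rfl⟩ | ⟨u, hu, rfl⟩)
    · exact (mul_mem_normSet_iff hw.ne_zero h3).mpr hu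
    · rw [← hs]
      exact (mul_mem_normSet_iff (by rw [hs]; exact hw.ne_zero) (by rwa [hs])).mpr hu

theorem ncard_normSet_mul_add {w : R₂} (hw : Prime w.norm) (h3 : ¬ 3 ∣ w.norm) (m : ℤ) :
    (normSet (w.norm * m)).ncard
      + ((fun z => w * z) '' normSet m ∩ (fun z => star w * z) '' normSet m).ncard
      = 2 * (normSet m).ncard := by
  have hs : (star w).norm = w.norm := Zsqrtd.norm_conj w
  rw [normSet_mul hw h3, Set.ncard_union_add_ncard_inter _ _ ((normSet_finite m).image _)
    ((normSet_finite m).image _), Set.ncard_image_of_injective _ (injective_mul hw.ne_zero),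
    Set.ncard_image_of_injective _ (injective_mul (by rw [hs]; exact hw.ne_zero)), two_mul]

theorem ncard_normSet_mul_of_not_dvd {w : R₂} (hw : Prime w.norm) (h2 : ¬ w.norm ∣ 2)
    (h3 : ¬ 3 ∣ w.norm) {m : ℤ} (hm : ¬ w.norm ∣ m) :
    (normSet (w.norm * m)).ncard = 2 * (normSet m).ncard := by
  rw [← ncard_normSet_mul_add hw h3]
  suffices (fun z => w * z) '' normSet m ∩ (fun z => star w * z) '' normSet m = ∅ by
    rw [this]; simp
  rw [Set.eq_empty_iff_forall_notMem]
  rintro z ⟨⟨u, hu, rfl⟩, ⟨v, hv, hz⟩⟩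
  obtain ⟨t, ht⟩ := intCast_dvd_of_dvd_of_star_dvd hw h2 (dvd_mul_right w u) ⟨v, hz.symm⟩
  have := congrArg Zsqrtd.norm ht
  simp only [Zsqrtd.norm_mul, hu.1, Zsqrtd.norm_intCast, mul_assoc] at this
  exact hm ⟨_, mul_left_cancel₀ hw.ne_zero this⟩

theorem ncard_normSet_mul_mul {w : R₂} (hw : Prime w.norm) (h2 : ¬ w.norm ∣ 2)
    (h3 : ¬ 3 ∣ w.norm) (m : ℤ) :
    (normSet (w.norm * (w.norm * m))).ncard + (normSet m).ncard
      = 2 * (normSet (w.norm * m)).ncard := by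
  have hs : (star w).norm = w.norm := Zsqrtd.norm_conj w
  rw [← ncard_normSet_mul_add hw h3]
  congr 1
  have hn : ((w.norm : ℤ) : R₂).norm ≠ 0 := by
    rw [Zsqrtd.norm_intCast]; exact mul_ne_zero hw.ne_zero hw.ne_zero
  rw [← Set.ncard_image_of_injective (normSet m) (injective_mul hn)]
  congr 1
  ext z
  constructor
  · rintro ⟨u, hu, rfl⟩
    refine ⟨⟨star w * u, ?_, ?_⟩, ⟨w * u, (mul_mem_normSet_iff hw.ne_zero h3).mpr hu, ?_⟩⟩
    · rw [← hs]
      exact (mul_mem_normSet_iff (by rw [hs]; exact hw.ne_zero) (by rwa [hs])).mpr hu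
    · simp only [Zsqrtd.norm_eq_mul_conj, mul_assoc]
    · simp only [Zsqrtd.norm_eq_mul_conj]; ring
  · rintro ⟨⟨u, hu, rfl⟩, ⟨v, hv, hz⟩⟩
    obtain ⟨t, ht⟩ := intCast_dvd_of_dvd_of_star_dvd hw h2 (dvd_mul_right w u) ⟨v, hz.symm⟩
    refine ⟨t, ?_, ht.symm⟩
    rw [Zsqrtd.norm_eq_mul_conj, mul_assoc] at ht
    have h' := mul_left_cancel_of_norm_ne_zero hw.ne_zero ht
    rw [h', ← hs] at hu
    exact (mul_mem_normSet_iff (by rw [hs]; exact hw.ne_zero) (by rwa [hs])).mp hu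

theorem ncard_normSet_pow_mul {w : R₂} (hw : Prime w.norm) (h2 : ¬ w.norm ∣ 2)
    (h3 : ¬ 3 ∣ w.norm) {m : ℤ} (hm : ¬ w.norm ∣ m) (e : ℕ) :
    (normSet (w.norm ^ e * m)).ncard = (e + 1) * (normSet m).ncard := by
  induction e using Nat.twoStepInduction with
  | zero => simp
  | one => simpa using ncard_normSet_mul_of_not_dvd hw h2 h3 hm
  | more e ih1 ih2 =>
    have := ncard_normSet_mul_mul hw h2 h3 (w.norm ^ e * m)
    rw [← mul_assoc w.norm (w.norm ^ e), ← pow_succ', ih1, ih2, ← mul_assoc, ← pow_succ'] at this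
    rw [show e + 1 + 1 = e + 2 from rfl] at this
    linarith

theorem normSet_pow_mul_eq_empty {q : ℤ} (hq : Prime q) (hr : ∀ x : ℤ, ¬ q ∣ x ^ 2 + 2) {m : ℤ}
    (hm : ¬ q ∣ m) (e : ℕ) : normSet (q ^ (2 * e + 1) * m) = ∅ := by
  have key : ∀ z : R₂, q ∣ z.norm → (q : R₂) ∣ z := by
    intro z hz
    refine intCast_dvd_of_dvd_im hq hz ?_
    by_contra him
    obtain ⟨u, v, huv⟩ := (Int.isCoprime_iff_gcd_eq_one.mpr
      ((Int.gcd_comm _ _).trans (Int.isCoprime_iff_gcd_eq_one.mp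
        ((hq.coprime_iff_not_dvd).mpr him))) : IsCoprime z.im q)
    apply hr (u * z.re)
    rw [norm_eq] at hz
    have : (u * z.re) ^ 2 + 2 = u ^ 2 * (z.re ^ 2 + 2 * z.im ^ 2)
        + q * (2 * v * (1 + u * z.im)) := by
      linear_combination (-2) * (1 + u * z.im) * huv
    rw [this]
    exact dvd_add (hz.mul_left _) (dvd_mul_right _ _)
  have main : ∀ e : ℕ, ∀ z : R₂, z.norm ≠ q ^ (2 * e + 1) * m := by
    intro e
    induction e with
    | zero =>
      intro z hz
      obtain ⟨t, rfl⟩ := key z ⟨m, by simpa using hz⟩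
      rw [Zsqrtd.norm_mul, Zsqrtd.norm_intCast, mul_assoc] at hz
      simp only [mul_zero, zero_add, pow_one] at hz
      exact hm ⟨_, (mul_left_cancel₀ hq.ne_zero hz).symm⟩
    | succ e ih =>
      intro z hz
      obtain ⟨t, rfl⟩ := key z ⟨q ^ (2 * e + 2) * m, by rw [hz]; ring⟩
      rw [Zsqrtd.norm_mul, Zsqrtd.norm_intCast] at hz
      refine ih t (mul_left_cancel₀ (mul_ne_zero hq.ne_zero hq.ne_zero) (hz.trans ?_))
      ring
  exact Set.eq_empty_iff_forall_notMem.mpr fun z hz => main e z hz.1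


theorem three_eq_mul_star : (3 : R₂) = ⟨1, 1⟩ * star ⟨1, 1⟩ := by
  ext <;> simp

theorem norm_one_one : (⟨1, 1⟩ : R₂).norm = 3 := by
  rw [norm_eq]; norm_num

theorem ncard_normSet_three_mul_eq_add (m : ℤ) :
    (normSet (3 * m)).ncard = {z : R₂ | z.norm = m ∧ ¬ star (⟨1, 1⟩ : R₂) ∣ z}.ncard
      + {z : R₂ | z.norm = m ∧ ¬ (⟨1, 1⟩ : R₂) ∣ z}.ncard := by
  set w : R₂ := ⟨1, 1⟩ with hw
  have hn : w.norm = 3 := norm_one_one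
  have hs : (star w).norm = 3 := by rw [Zsqrtd.norm_conj, hn]
  have h3 : (3 : R₂) = w * star w := three_eq_mul_star
  have i1 := injective_mul (w := w) (by rw [hn]; norm_num)
  have i2 := injective_mul (w := star w) (by rw [hs]; norm_num)
  have d1 : ∀ u, (3 : R₂) ∣ w * u ↔ star w ∣ u := by
    intro u
    rw [h3]
    refine ⟨fun ⟨t, ht⟩ => ⟨t, i1 ?_⟩, mul_dvd_mul_left _⟩
    simpa [mul_assoc] using ht
  have d2 : ∀ u, (3 : R₂) ∣ star w * u ↔ w ∣ u := by
    intro u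
    rw [h3, mul_comm w]
    refine ⟨fun ⟨t, ht⟩ => ⟨t, i2 ?_⟩, mul_dvd_mul_left _⟩
    simpa [mul_assoc] using ht
  have e : normSet (3 * m) = (fun z => w * z) '' {z : R₂ | z.norm = m ∧ ¬ star w ∣ z}
      ∪ (fun z => star w * z) '' {z : R₂ | z.norm = m ∧ ¬ w ∣ z} := by
    ext z
    constructor
    · rintro ⟨h, h'⟩
      rcases dvd_or_star_dvd (w := w) (z := z) (by rw [hn]; exact Int.prime_three)
        (by rw [hn, h]; exact dvd_mul_right _ _) with ⟨u, rfl⟩ | ⟨u, rfl⟩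
      · rw [Zsqrtd.norm_mul, hn] at h
        exact Or.inl ⟨u, ⟨by linarith, by rwa [d1] at h'⟩, rfl⟩
      · rw [Zsqrtd.norm_mul, hs] at h
        exact Or.inr ⟨u, ⟨by linarith, by rwa [d2] at h'⟩, rfl⟩
    · rintro (⟨u, ⟨hu, hu'⟩, rfl⟩ | ⟨u, ⟨hu, hu'⟩, rfl⟩)
      · exact ⟨by rw [Zsqrtd.norm_mul, hn, hu], by rwa [d1]⟩
      · exact ⟨by rw [Zsqrtd.norm_mul, hs, hu], by rwa [d2]⟩
  have f1 : {z : R₂ | z.norm = m ∧ ¬ star w ∣ z}.Finite :=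
    (finite_norm_eq m).subset fun _ hz => hz.1
  have f2 : {z : R₂ | z.norm = m ∧ ¬ w ∣ z}.Finite :=
    (finite_norm_eq m).subset fun _ hz => hz.1
  rw [e, Set.ncard_union_eq ?_ (f1.image _) (f2.image _), Set.ncard_image_of_injective _ i1,
    Set.ncard_image_of_injective _ i2]
  rw [Set.disjoint_left]
  rintro z ⟨u, ⟨hu, hu'⟩, rfl⟩ ⟨v, ⟨hv, hv'⟩, hz⟩
  apply hu'
  rw [← d1]
  have := intCast_dvd_of_dvd_of_star_dvd (w := w) (z := w * u) (by rw [hn]; exact Int.prime_three)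
    (by rw [hn]; norm_num) (dvd_mul_right _ _) ⟨v, hz.symm⟩
  rw [hn] at this
  exact_mod_cast this

theorem norm_dvd_norm {w z : R₂} (h : w ∣ z) : w.norm ∣ z.norm := by
  obtain ⟨u, rfl⟩ := h
  rw [Zsqrtd.norm_mul]; exact dvd_mul_right _ _

theorem ncard_normSet_three_mul_of_not_dvd {m : ℤ} (hm : ¬ 3 ∣ m) :
    (normSet (3 * m)).ncard = 2 * (normSet m).ncard := by
  rw [ncard_normSet_three_mul_eq_add, two_mul]
  have hs : (star (⟨1, 1⟩ : R₂)).norm = 3 := by rw [Zsqrtd.norm_conj, norm_one_one]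
  have h : ∀ z : R₂, z.norm = m → ∀ w : R₂, w.norm = 3 → ¬ w ∣ z := by
    rintro z rfl w hw hwz
    exact hm (hw ▸ norm_dvd_norm hwz)
  have h' : ∀ z : R₂, z.norm = m → ¬ (3 : R₂) ∣ z := fun z hz hd =>
    h z hz _ norm_one_one ((Dvd.intro _ three_eq_mul_star.symm).trans hd)
  congr 2 <;> ext z <;> simp only [normSet, Set.mem_ofPred_eq] <;>
    refine and_congr_right fun hz => ?_
  · exact iff_of_true (h z hz _ hs) (h' z hz)
  · exact iff_of_true (h z hz _ norm_one_one) (h' z hz)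

theorem ncard_normSet_three_mul_of_dvd {m : ℤ} (hm : 3 ∣ m) :
    (normSet (3 * m)).ncard = (normSet m).ncard := by
  rw [ncard_normSet_three_mul_eq_add]
  have key : ∀ z : R₂, z.norm = m → (⟨1, 1⟩ : R₂) ∣ z ∨ star (⟨1, 1⟩ : R₂) ∣ z := by
    rintro z rfl
    exact dvd_or_star_dvd (by rw [norm_one_one]; exact Int.prime_three) (by rwa [norm_one_one])
  have key' : ∀ z : R₂, (3 : R₂) ∣ z ↔ (⟨1, 1⟩ : R₂) ∣ z ∧ star (⟨1, 1⟩ : R₂) ∣ z := by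
    intro z
    constructor
    · intro h
      rw [three_eq_mul_star] at h
      exact ⟨(dvd_mul_right _ _).trans h, (dvd_mul_left _ _).trans h⟩
    · rintro ⟨h, h'⟩
      have := intCast_dvd_of_dvd_of_star_dvd (by rw [norm_one_one]; exact Int.prime_three)
        (by rw [norm_one_one]; norm_num) h h'
      rw [norm_one_one] at this
      exact_mod_cast this
  rw [← Set.ncard_union_eq ?_ ((finite_norm_eq m).subset fun _ hz => hz.1)
    ((finite_norm_eq m).subset fun _ hz => hz.1)]
  · congr 1
    ext z
    simp only [normSet, Set.mem_ofPred_eq, Set.mem_union, key']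
    tauto
  · rw [Set.disjoint_left]
    rintro z ⟨h1, h2⟩ ⟨h3, h4⟩
    exact (key z h1).elim h4 h2

/-- The pairs of natural numbers `(x, y)`, not both divisible by `3`, with `x² + 2y² = N`. -/
def reps (N : ℕ) : Finset (ℕ × ℕ) :=
  (Finset.range (N + 1) ×ˢ Finset.range (N + 1)).filter
    fun p => p.1 ^ 2 + 2 * p.2 ^ 2 = N ∧ ¬ (3 ∣ p.1 ∧ 3 ∣ p.2)

theorem mem_reps {N : ℕ} {p : ℕ × ℕ} :
    p ∈ reps N ↔ p.1 ^ 2 + 2 * p.2 ^ 2 = N ∧ ¬ (3 ∣ p.1 ∧ 3 ∣ p.2) := by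
  simp only [reps, Finset.mem_filter, Finset.mem_product, Finset.mem_range, and_iff_right_iff_imp]
  rintro ⟨h, -⟩
  constructor <;> nlinarith [Nat.le_self_pow two_ne_zero p.1, Nat.le_self_pow two_ne_zero p.2]

theorem three_dvd_iff (z : R₂) : (3 : R₂) ∣ z ↔ 3 ∣ z.re.natAbs ∧ 3 ∣ z.im.natAbs := by
  rw [show (3 : R₂) = ((3 : ℤ) : R₂) by norm_cast, Zsqrtd.intCast_dvd]
  omega

theorem natAbs_mem_reps {N : ℕ} {z : R₂} :
    (z.re.natAbs, z.im.natAbs) ∈ reps N ↔ z ∈ normSet N := by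
  rw [mem_reps, normSet, Set.mem_ofPred_eq, three_dvd_iff, norm_eq]
  refine and_congr_left fun _ => ?_
  zify
  simp [sq_abs]

theorem ncard_normSet_eq_sum {N : ℕ} (hN : Odd N) :
    (normSet N).ncard = ∑ p ∈ reps N, if p.2 = 0 then 2 else 4 := by
  classical
  rw [Set.ncard_eq_toFinset_card _ (normSet_finite N), Finset.card_eq_sum_card_fiberwise
    (f := fun z : R₂ => (z.re.natAbs, z.im.natAbs)) (t := reps N)]
  · refine Finset.sum_congr rfl ?_
    rintro ⟨a, b⟩ hab
    have ha : a ≠ 0 := by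
      rintro rfl
      have h0 : 0 ^ 2 + 2 * b ^ 2 = N := (mem_reps.mp hab).1
      rw [Nat.odd_iff] at hN
      omega
    have : (normSet_finite N).toFinset.filter
        (fun z : R₂ => (z.re.natAbs, z.im.natAbs) = (a, b)) =
        {⟨a, b⟩, ⟨a, -b⟩, ⟨-a, b⟩, ⟨-a, -b⟩} := by
      ext z
      simp only [Finset.mem_filter, Set.Finite.mem_toFinset, Finset.mem_insert,
        Finset.mem_singleton, Zsqrtd.ext_iff, ← natAbs_mem_reps]
      constructor
      · rintro ⟨-, h⟩
        simp only [Prod.mk.injEq] at h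
        omega
      · intro h
        have : (z.re.natAbs, z.im.natAbs) = (a, b) := by
          simp only [Prod.mk.injEq]
          omega
        exact ⟨this ▸ hab, this⟩
    rw [this]
    split_ifs with hb
    · have hb' : b = 0 := hb
      subst hb'
      simp only [Nat.cast_zero, neg_zero, Finset.insert_idem]
      rw [Finset.pair_eq_singleton, Finset.card_pair]
      rw [Ne, Zsqrtd.ext_iff]; simp only; omega
    · have hb' : b ≠ 0 := hb
      rw [Finset.card_insert_of_notMem, Finset.card_insert_of_notMem, Finset.card_pair] <;>
        simp only [Ne, Finset.mem_insert, Finset.mem_singleton, Zsqrtd.ext_iff] <;> omega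
  · intro z hz
    simpa using natAbs_mem_reps.mpr (by simpa using hz)

theorem ncard_normSet_of_mod_eight_eq_three {N : ℕ} (hN : N % 8 = 3) :
    (normSet N).ncard = 4 * (reps N).card := by
  rw [ncard_normSet_eq_sum (by rw [Nat.odd_iff]; omega), Finset.sum_congr rfl (g := fun _ => 4)]
  · simp [mul_comm]
  · intro p hp
    rw [if_neg]
    intro h0
    have h := (mem_reps.mp hp).1
    rw [h0] at h
    have : (p.1 * p.1) % 8 = 3 := by rw [← hN, ← h]; ring_nf
    rw [Nat.mul_mod] at this
    have hlt := Nat.mod_lt p.1 (show 0 < 8 by norm_num)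
    interval_cases p.1 % 8 <;> omega

open Classical in
theorem ncard_normSet_modEq_four {N : ℕ} (hN : Odd N) (h3 : ¬ 3 ∣ N) :
    (normSet N).ncard ≡ if IsSquare N then 2 else 0 [MOD 4] := by
  rw [ncard_normSet_eq_sum hN, Finset.sum_ite, Finset.sum_const, Finset.sum_const, smul_eq_mul,
    smul_eq_mul]
  have key : ((reps N).filter fun p => p.2 = 0).card = if IsSquare N then 1 else 0 := by
    split_ifs with h
    · obtain ⟨t, rfl⟩ := h
      rw [Finset.card_eq_one]
      refine ⟨(t, 0), ?_⟩
      ext ⟨x, y⟩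
      simp only [Finset.mem_filter, mem_reps, Finset.mem_singleton, Prod.mk.injEq]
      constructor
      · rintro ⟨⟨h, -⟩, rfl⟩
        refine ⟨?_, rfl⟩
        rw [← sq] at h
        exact Nat.pow_left_injective two_ne_zero (by simpa using h)
      · rintro ⟨rfl, rfl⟩
        exact ⟨⟨by ring, fun hh => h3 (hh.1.mul_right _)⟩, rfl⟩
    · rw [Finset.card_eq_zero, Finset.filter_eq_empty_iff]
      intro p hp h0
      have := (mem_reps.mp hp).1
      rw [h0] at this
      exact h ⟨p.1, by rw [← this]; ring⟩
  rw [key]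
  split_ifs <;> simp [Nat.ModEq]

open Classical in
theorem ncard_normSet_three_mul_modEq (M : ℕ) (hM : M % 8 = 1) :
    (normSet ((3 * M : ℕ) : ℤ)).ncard ≡ if IsSquare M then 4 else 0 [MOD 8] := by
  induction M using Nat.strong_induction_on with
  | _ M ih =>
  have two : ∀ {a b : ℕ}, a ≡ b [MOD 4] → 2 * a ≡ 2 * b [MOD 8] := fun h => h.mul_left' 2
  by_cases h3 : 3 ∣ M
  · obtain ⟨m, rfl⟩ := h3
    push_cast
    rw [ncard_normSet_three_mul_of_dvd (dvd_mul_right _ _)]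
    by_cases h9 : 3 ∣ m
    · obtain ⟨n, rfl⟩ := h9
      push_cast
      rw [ncard_normSet_three_mul_of_dvd (dvd_mul_right _ _)]
      have hs : IsSquare (3 * (3 * n)) ↔ IsSquare n := by
        constructor
        · rintro ⟨t, ht⟩
          have h3t : 3 ∣ t := by
            have : 3 ∣ t * t := ⟨_, ht.symm⟩
            exact (Nat.prime_three.dvd_mul.mp this).elim id id
          obtain ⟨s, rfl⟩ := h3t
          exact ⟨s, by linarith⟩
        · rintro ⟨t, rfl⟩
          exact ⟨3 * t, by ring⟩
      simp only [hs]
      exact_mod_cast ih n (by omega) (by omega)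
    · rw [ncard_normSet_three_mul_of_not_dvd (by exact_mod_cast h9), if_neg]
      · have h := ncard_normSet_modEq_four (N := m) (by rw [Nat.odd_iff]; omega) h9
        rw [if_neg] at h
        · exact two h
        · rintro ⟨t, rfl⟩
          have hm : (3 * ((t % 8) * (t % 8))) % 8 = 1 := by
            rw [← hM]; simp [Nat.mul_mod]
          have hlt := Nat.mod_lt t (show 0 < 8 by norm_num)
          interval_cases t % 8 <;> omega
      · rintro ⟨t, ht⟩
        apply h9
        have h3t : 3 ∣ t := by
          have : 3 ∣ t * t := ⟨_, ht.symm⟩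
          exact (Nat.prime_three.dvd_mul.mp this).elim id id
        obtain ⟨s, rfl⟩ := h3t
        exact ⟨s * s, by linarith⟩
  · push_cast
    rw [ncard_normSet_three_mul_of_not_dvd (by exact_mod_cast h3)]
    have h := two (ncard_normSet_modEq_four (N := M) (by rw [Nat.odd_iff]; omega) h3)
    split_ifs at h ⊢ <;> exact h

open Classical in
theorem card_reps_three_mul_modEq {M : ℕ} (hM : M % 8 = 1) :
    (reps (3 * M)).card ≡ if IsSquare M then 1 else 0 [MOD 2] := by
  have h := ncard_normSet_three_mul_modEq M hM
  rw [ncard_normSet_of_mod_eight_eq_three (by omega)] at h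
  apply Nat.ModEq.mul_left_cancel' (c := 4) (by norm_num)
  split_ifs at h ⊢ <;> exact h

theorem exists_norm_eq {q : ℕ} (hq : q.Prime) {x : ℤ} (hx : (q : ℤ) ∣ x ^ 2 + 2) :
    ∃ w : R₂, w.norm = q := by
  obtain ⟨s, hs⟩ : ∃ s, s = Nat.sqrt q := ⟨_, rfl⟩
  have hlt : q < (s + 1) * (s + 1) := hs ▸ Nat.lt_succ_sqrt q
  have hle : s * s < q := by
    refine lt_of_le_of_ne (hs ▸ Nat.sqrt_le q) fun h => ?_
    exact hq.prime.irreducible.not_isSquare ⟨s, h.symm⟩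
  have := Fact.mk hq
  let f : ℕ × ℕ → ZMod q := fun p => p.1 - x * p.2
  obtain ⟨p, hp, p', hp', hne, hf⟩ := Finset.exists_ne_map_eq_of_card_lt_of_maps_to
    (s := Finset.range (s + 1) ×ˢ Finset.range (s + 1)) (t := (Finset.univ : Finset (ZMod q)))
    (by simpa [ZMod.card] using hlt) (f := f) (fun _ _ => Finset.mem_coe.mpr (Finset.mem_univ _))
  simp only [Finset.mem_product, Finset.mem_range] at hp hp'
  obtain ⟨a, ha⟩ : ∃ a : ℤ, a = p.1 - p'.1 := ⟨_, rfl⟩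
  obtain ⟨b, hb⟩ : ∃ b : ℤ, b = p.2 - p'.2 := ⟨_, rfl⟩
  have hdvd : (q : ℤ) ∣ a - x * b := by
    rw [← ZMod.intCast_zmod_eq_zero_iff_dvd, ha, hb]
    push_cast
    simp only [f] at hf
    linear_combination hf
  have hd : (q : ℤ) ∣ a ^ 2 + 2 * b ^ 2 := by
    have : a ^ 2 + 2 * b ^ 2 = (a - x * b) * (a + x * b) + (x ^ 2 + 2) * b ^ 2 := by ring
    rw [this]
    exact dvd_add (hdvd.mul_right _) (hx.mul_right _)
  have ha2 : a ^ 2 < q := by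
    have : a ^ 2 ≤ (s : ℤ) ^ 2 := sq_le_sq' (by omega) (by omega)
    zify at hle; nlinarith
  have hb2 : b ^ 2 < q := by
    have : b ^ 2 ≤ (s : ℤ) ^ 2 := sq_le_sq' (by omega) (by omega)
    zify at hle; nlinarith
  have hpos : 0 < a ^ 2 + 2 * b ^ 2 := by
    rcases eq_or_ne a 0 with h0 | h0
    · rcases eq_or_ne b 0 with h1 | h1
      · exact absurd (Prod.ext (by omega) (by omega)) hne
      · positivity
    · positivity
  obtain ⟨k, hk⟩ := hd
  have hq0 : (0 : ℤ) < q := by exact_mod_cast hq.pos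
  have hk0 : 0 < k := by
    by_contra h
    nlinarith
  have hk3 : k < 3 := by
    by_contra h
    nlinarith
  obtain rfl | rfl : k = 1 ∨ k = 2 := by omega
  · exact ⟨⟨a, b⟩, by rw [norm_eq]; simpa using hk⟩
  · have hae : Even a := by
      have : Even (a ^ 2) := ⟨q - b ^ 2, by linarith⟩
      exact (Int.even_pow' two_ne_zero).mp this
    obtain ⟨c, rfl⟩ := hae
    exact ⟨⟨b, c⟩, by rw [norm_eq]; simp only; linarith⟩

theorem even_card_reps_pow_mul {p : ℕ} (hp : p.Prime) (hp5 : 5 ≤ p) {M : ℕ} (hM : ¬ p ∣ M)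
    (k : ℕ) (h8 : (p ^ (4 * k + 3) * M) % 8 = 3) :
    Even (reps (p ^ (4 * k + 3) * M)).card := by
  have hcard := ncard_normSet_of_mod_eight_eq_three h8
  push_cast at hcard
  have hpZ : Prime (p : ℤ) := Nat.prime_iff_prime_int.mp hp
  have hMZ : ¬ (p : ℤ) ∣ M := by exact_mod_cast hM
  by_cases hx : ∃ x : ℤ, (p : ℤ) ∣ x ^ 2 + 2
  · obtain ⟨x, hx⟩ := hx
    obtain ⟨w, hw⟩ := exists_norm_eq hp hx
    have h := ncard_normSet_pow_mul (w := w) (m := M) (by rwa [hw])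
      (by
        rw [hw]; intro h
        have := Nat.le_of_dvd (by norm_num) (Int.natCast_dvd_natCast.mp h : p ∣ 2)
        omega)
      (by
        rw [hw]; intro h
        have := (Nat.prime_dvd_prime_iff_eq Nat.prime_three hp).mp (Int.natCast_dvd_natCast.mp h)
        omega) (by rwa [hw]) (4 * k + 3)
    rw [hw, hcard] at h
    have hodd : Odd M := by
      rw [← Nat.not_even_iff_odd]
      intro he
      have := Nat.even_iff.mp (he.mul_left (p ^ (4 * k + 3)))
      omega
    have he : Even (normSet (M : ℤ)).ncard := by
      rw [ncard_normSet_eq_sum hodd]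
      refine Finset.even_sum _ fun p _ => ?_
      split_ifs <;> decide
    obtain ⟨c, hc⟩ := he
    rw [hc] at h
    refine ⟨(k + 1) * c, ?_⟩
    have : 4 * (reps (p ^ (4 * k + 3) * M)).card = 4 * ((k + 1) * c + (k + 1) * c) := by
      rw [h]; ring
    omega
  · push Not at hx
    have h := normSet_pow_mul_eq_empty hpZ hx hMZ (2 * k + 1)
    rw [show 2 * (2 * k + 1) + 1 = 4 * k + 3 by ring] at h
    rw [h, Set.ncard_empty] at hcard
    have : (reps (p ^ (4 * k + 3) * M)).card = 0 := by omega
    rw [this]; exact Even.zero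

end ZsqrtdNegTwo

section SquareResidues

theorem sq_mod_three (x : ℕ) : x ^ 2 % 3 = if 3 ∣ x then 0 else 1 := by
  simp only [Nat.pow_mod x 2 3, Nat.dvd_iff_mod_eq_zero]
  have := Nat.mod_lt x (show 0 < 3 by norm_num)
  interval_cases x % 3 <;> rfl

theorem sq_mod_eight_of_odd {x : ℕ} (hx : x % 2 = 1) : x ^ 2 % 8 = 1 := by
  have h : x % 8 % 2 = 1 := by omega
  rw [Nat.pow_mod]
  have := Nat.mod_lt x (show 0 < 8 by norm_num)
  interval_cases x % 8 <;> simp_all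

theorem sq_mod_four_of_even {x : ℕ} (hx : x % 2 = 0) : x ^ 2 % 4 = 0 := by
  obtain ⟨y, rfl⟩ := Nat.dvd_of_mod_eq_zero hx
  rw [mul_pow]; omega

theorem odd_of_sq_add_two_mul_sq {x y : ℕ} (h : (x ^ 2 + 2 * y ^ 2) % 8 = 3) :
    x % 2 = 1 ∧ y % 2 = 1 := by
  rcases Nat.mod_two_eq_zero_or_one x with hx | hx <;>
  rcases Nat.mod_two_eq_zero_or_one y with hy | hy
  · have := sq_mod_four_of_even hx; omega
  · have := sq_mod_four_of_even hx; omega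
  · have := sq_mod_eight_of_odd hx
    have := sq_mod_four_of_even hy
    omega
  · exact ⟨hx, hy⟩

end SquareResidues

section GeneratingFunctions

open PowerSeries WithPiTopology

theorem coeff_pentagonalSeries_zmod_two (n : ℕ) [Decidable (IsSquare (24 * n + 1))] :
    (pentagonalSeries (ZMod 2)).coeff n = if IsSquare (24 * n + 1) then 1 else 0 := by
  split_ifs with h
  · obtain ⟨t, ht⟩ := h
    have h8 : t % 2 = 1 := by
      refine (Nat.mod_two_eq_zero_or_one t).resolve_left fun h0 => ?_
      have := sq_mod_four_of_even h0
      rw [sq] at this; omega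
    have h3 : ¬ 3 ∣ t := by
      intro h0
      have := sq_mod_three t
      rw [if_pos h0, sq] at this; omega
    obtain ⟨k, hk⟩ : ∃ k : ℤ, (6 * k - 1) ^ 2 = (t : ℤ) ^ 2 := by
      rcases (by omega : t % 6 = 5 ∨ t % 6 = 1) with h | h
      · exact ⟨(t + 1) / 6, by congr 1; omega⟩
      · refine ⟨-((t - 1) / 6), ?_⟩
        rw [← neg_sq]; congr 1; omega
    have hn : pentagonal k = n := by
      have := two_mul_natCast_pentagonal k
      zify at ht ⊢
      linarith
    rw [← hn, coeff_pentagonalSeries_pentagonal]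
    rcases Int.units_eq_one_or k.negOnePow with h | h <;> rw [h] <;> decide
  · apply coeff_pentagonalSeries_eq_zero
    rintro ⟨k, rfl⟩
    apply h
    have := two_mul_natCast_pentagonal k
    refine ⟨(6 * k - 1).natAbs, ?_⟩
    zify
    rw [← abs_mul, abs_mul_self]
    linarith

theorem expand_two_zmod_two (f : PowerSeries (ZMod 2)) :
    expand 2 two_ne_zero f = f ^ 2 := by
  have h := MvPowerSeries.map_frobenius_expand (σ := Unit) (R := ZMod 2) (p := 2)
    (hp := two_ne_zero) (f := f)
  rw [ZMod.frobenius_zmod] at h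
  rw [← h]
  exact (MvPowerSeries.ext fun n => by rfl)

theorem hasProd_one_sub_X_pow_mul {R : Type*} [CommRing R] [TopologicalSpace R] (t : ℕ)
    (ht : t ≠ 0) :
    HasProd (fun n => (1 - X ^ ((n + 1) * t) : PowerSeries R))
      (expand t ht (pentagonalSeries R)) := by
  rw [HasProd, tendsto_iff_coeff_tendsto]
  intro n
  apply tendsto_nhds_of_eventually_eq
  rw [SummationFilter.unconditional_filter]
  filter_upwards [coeff_prod_one_sub_X_pow_eventually_eq R (n / t)] with s hs
  have : ∏ i ∈ s, (1 - X ^ ((i + 1) * t) : PowerSeries R)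
      = expand t ht (∏ i ∈ s, (1 - X ^ (i + 1))) := by
    rw [map_prod]
    refine Finset.prod_congr rfl fun i _ => ?_
    rw [map_sub, map_one, map_pow, expand_X, ← pow_mul, mul_comm]
  rw [this, coeff_expand, coeff_expand, hs]

theorem regularPartitionCount_eq_card_countRestricted {t : ℕ} (ht : 0 < t) (n : ℕ) :
    regularPartitionCount t n = (Nat.Partition.countRestricted n t).card := by
  rw [← Nat.Partition.card_restricted_eq_card_countRestricted n ht, regularPartitionCount,
    Nat.Partition.restricted, Nat.card_eq_fintype_card, Fintype.card_subtype]

theorem mk_regularPartitionCount_mul_pentagonalSeries (R : Type*) [CommRing R] [NoZeroDivisors R]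
    {t : ℕ} (ht : t ≠ 0) :
    PowerSeries.mk (fun n => (regularPartitionCount t n : R)) * pentagonalSeries R
      = expand t ht (pentagonalSeries R) := by
  let _ : TopologicalSpace R := ⊥
  have _ : DiscreteTopology R := ⟨rfl⟩
  simp only [regularPartitionCount_eq_card_countRestricted (Nat.pos_of_ne_zero ht)]
  have h := (Nat.Partition.hasProd_powerSeriesMk_card_countRestricted R
    (Nat.pos_of_ne_zero ht)).mul (hasProd_one_sub_X_pow R)
  refine h.unique ?_
  convert! hasProd_one_sub_X_pow_mul t ht using 2 with i
  simp_rw [pow_mul, geom_sum_mul_neg]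

theorem mk_B_eight_three :
    PowerSeries.mk (fun n => (B 8 3 n : ZMod 2))
      = expand 2 two_ne_zero (pentagonalSeries (ZMod 2)
          * expand 2 two_ne_zero (pentagonalSeries (ZMod 2)))
        * expand 3 three_ne_zero (pentagonalSeries (ZMod 2)) := by
  set P := pentagonalSeries (ZMod 2) with hP
  have hP0 : P ≠ 0 := by
    intro h
    have := coeff_pentagonalSeries_pentagonal (ZMod 2) 0
    rw [← hP, h] at this
    simp at this
  have h8 := mk_regularPartitionCount_mul_pentagonalSeries (ZMod 2) (t := 8) (by norm_num)
  have h3 := mk_regularPartitionCount_mul_pentagonalSeries (ZMod 2) (t := 3) (by norm_num)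
  rw [← hP] at h8 h3
  have e8 : expand 8 (by norm_num) P = P ^ 8 := by
    have := expand_mul 2 two_ne_zero 4 (by norm_num) P
    have h4 := expand_mul 2 two_ne_zero 2 two_ne_zero P
    simp only [expand_two_zmod_two, ← pow_mul, Nat.reduceMul] at h4
    rw [h4] at this
    simp only [expand_two_zmod_two, ← pow_mul, Nat.reduceMul] at this
    exact this
  have hB : PowerSeries.mk (fun n => (B 8 3 n : ZMod 2))
      = PowerSeries.mk (fun n => (regularPartitionCount 8 n : ZMod 2))
        * PowerSeries.mk (fun n => (regularPartitionCount 3 n : ZMod 2)) := by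
    ext n
    rw [coeff_mk, coeff_mul, Finset.Nat.sum_antidiagonal_eq_sum_range_succ_mk, B]
    push_cast
    simp
  rw [e8] at h8
  rw [hB]
  apply mul_right_cancel₀ (mul_ne_zero hP0 hP0)
  rw [expand_two_zmod_two, expand_two_zmod_two, mul_mul_mul_comm, h8, h3]
  ring

open Classical in
theorem coeff_pentagonalSeries_mul_expand_two (n : ℕ) :
    (pentagonalSeries (ZMod 2) * expand 2 two_ne_zero (pentagonalSeries (ZMod 2))).coeff n
      = if IsSquare (8 * n + 1) then 1 else 0 := by
  have hreps : (pentagonalSeries (ZMod 2)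
      * expand 2 two_ne_zero (pentagonalSeries (ZMod 2))).coeff n
      = ((ZsqrtdNegTwo.reps (3 * (8 * n + 1))).card : ZMod 2) := by
    rw [coeff_mul]
    simp only [coeff_expand, coeff_pentagonalSeries_zmod_two, ← ite_and, ite_mul, one_mul,
      zero_mul]
    rw [Finset.sum_boole]
    congr 1
    symm
    have facts : ∀ p ∈ ZsqrtdNegTwo.reps (3 * (8 * n + 1)), p.1 ^ 2 % 24 = 1 ∧ p.2 ^ 2 % 24 = 1 := by
      intro p hp
      obtain ⟨h, h'⟩ := ZsqrtdNegTwo.mem_reps.mp hp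
      obtain ⟨hx, hy⟩ := odd_of_sq_add_two_mul_sq (x := p.1) (y := p.2) (by omega)
      have h1 := sq_mod_eight_of_odd hx
      have h2 := sq_mod_eight_of_odd hy
      have h3 := sq_mod_three p.1
      have h4 := sq_mod_three p.2
      split_ifs at h3 h4 <;> omega
    refine Finset.card_bij (fun p _ => ((p.1 ^ 2 - 1) / 24, (p.2 ^ 2 - 1) / 12)) ?_ ?_ ?_
    · intro p hp
      obtain ⟨h1, h2⟩ := facts p hp
      have h := (ZsqrtdNegTwo.mem_reps.mp hp).1
      simp only [Finset.mem_filter, Finset.HasAntidiagonal.mem_antidiagonal]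
      refine ⟨by omega, ⟨p.1, ?_⟩, by omega, ⟨p.2, ?_⟩⟩ <;> rw [← sq] <;> omega
    · intro p hp p' hp' h
      obtain ⟨h1, h2⟩ := facts p hp
      obtain ⟨h3, h4⟩ := facts p' hp'
      simp only [Prod.mk.injEq] at h
      exact Prod.ext (Nat.pow_left_injective two_ne_zero (by simp only; omega))
        (Nat.pow_left_injective two_ne_zero (by simp only; omega))
    · rintro ⟨i, j⟩ hij
      simp only [Finset.mem_filter, Finset.HasAntidiagonal.mem_antidiagonal] at hij
      obtain ⟨hij, ⟨s, hs⟩, hj, ⟨t, ht⟩⟩ := hij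
      rw [← sq] at hs ht
      refine ⟨(s, t), ZsqrtdNegTwo.mem_reps.mpr ⟨by simp only; omega, fun h => ?_⟩, ?_⟩
      · have := sq_mod_three s
        rw [if_pos h.1] at this
        omega
      · simp only [Prod.mk.injEq]; omega
  rw [hreps]
  have := (ZMod.natCast_eq_natCast_iff _ _ 2).mpr
    (ZsqrtdNegTwo.card_reps_three_mul_modEq (M := 8 * n + 1) (by omega))
  rw [this]
  split_ifs <;> simp

theorem natCast_B_eight_three (n : ℕ) : (B 8 3 n : ZMod 2)
    = (((ZsqrtdNegTwo.reps (8 * n + 3)).filter fun p => ¬ 3 ∣ p.1).card : ZMod 2) := by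
  classical
  have h := congrArg (PowerSeries.coeff n) mk_B_eight_three
  rw [coeff_mk, coeff_mul] at h
  rw [h]
  simp only [coeff_expand, coeff_pentagonalSeries_mul_expand_two,
    coeff_pentagonalSeries_zmod_two, ← ite_and, ite_mul, one_mul, zero_mul]
  rw [Finset.sum_boole]
  congr 1
  symm
  have facts : ∀ p ∈ (ZsqrtdNegTwo.reps (8 * n + 3)).filter fun p => ¬ 3 ∣ p.1,
      p.1 ^ 2 + 2 * p.2 ^ 2 = 8 * n + 3 ∧ p.1 ^ 2 % 24 = 1 ∧ p.2 ^ 2 % 8 = 1 := by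
    intro p hp
    obtain ⟨hp, h3⟩ := Finset.mem_filter.mp hp
    have h := (ZsqrtdNegTwo.mem_reps.mp hp).1
    obtain ⟨hx, hy⟩ := odd_of_sq_add_two_mul_sq (x := p.1) (y := p.2) (by omega)
    have h1 := sq_mod_eight_of_odd hx
    have h2 := sq_mod_eight_of_odd hy
    have h4 := sq_mod_three p.1
    rw [if_neg h3] at h4
    omega
  refine Finset.card_bij (fun p _ => ((p.2 ^ 2 - 1) / 4, (p.1 ^ 2 - 1) / 8)) ?_ ?_ ?_
  · intro p hp
    obtain ⟨h, h1, h2⟩ := facts p hp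
    simp only [Finset.mem_filter, Finset.HasAntidiagonal.mem_antidiagonal]
    refine ⟨by omega, ⟨by omega, ⟨p.2, ?_⟩⟩, by omega, ⟨p.1, ?_⟩⟩ <;> rw [← sq] <;> omega
  · intro p hp p' hp' h
    obtain ⟨-, h1, h2⟩ := facts p hp
    obtain ⟨-, h3, h4⟩ := facts p' hp'
    simp only [Prod.mk.injEq] at h
    exact Prod.ext (Nat.pow_left_injective two_ne_zero (by simp only; omega))
      (Nat.pow_left_injective two_ne_zero (by simp only; omega))
  · rintro ⟨i, j⟩ hij
    simp only [Finset.mem_filter, Finset.HasAntidiagonal.mem_antidiagonal] at hij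
    obtain ⟨hij, ⟨hi, ⟨t, ht⟩⟩, hj, ⟨s, hs⟩⟩ := hij
    rw [← sq] at hs ht
    have h3 : ¬ 3 ∣ s := fun h => by
      have := sq_mod_three s
      rw [if_pos h] at this
      omega
    refine ⟨(s, t), Finset.mem_filter.mpr ⟨ZsqrtdNegTwo.mem_reps.mpr
      ⟨by simp only; omega, fun h => h3 h.1⟩, h3⟩, ?_⟩
    simp only [Prod.mk.injEq]; omega

end GeneratingFunctions

theorem even_B_eight_three_of_even_card_reps {n : ℕ}
    (h : Even (ZsqrtdNegTwo.reps (8 * n + 3)).card) : Even (B 8 3 n) := by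
  rw [← ZMod.natCast_eq_zero_iff_even, natCast_B_eight_three, ZMod.natCast_eq_zero_iff_even]
  by_cases h2 : (8 * n + 3) % 3 = 2
  · rw [Finset.card_eq_zero.mpr]
    · exact Even.zero
    rw [Finset.filter_eq_empty_iff]
    intro p hp h3
    have h0 := (ZsqrtdNegTwo.mem_reps.mp hp).1
    have h1 := sq_mod_three p.1
    have h4 := sq_mod_three p.2
    rw [if_neg h3] at h1
    split_ifs at h4 <;> omega
  · rwa [Finset.filter_true_of_mem]
    intro p hp h3
    obtain ⟨h0, h5⟩ := ZsqrtdNegTwo.mem_reps.mp hp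
    have h1 := sq_mod_three p.1
    have h4 := sq_mod_three p.2
    rw [if_pos h3] at h1
    rw [if_neg fun h => h5 ⟨h3, h⟩] at h4
    omega

/-- Theorem 1.9(i). -/
theorem B_8_3_cong_i (p : ℕ) (hp : p.Prime) (hp5 : 5 ≤ p)
    (hw : w2 p hp ≡ 0 [ZMOD 2]) (n k : ℕ) (hn : ¬ p ∣ n) :
    B 8 3 (p ^ (4 * k + 3) * n + 3 * (p ^ (4 * k + 4) - 1) / 8) ≡ 0 [MOD 2] := by
  have hodd : p % 2 = 1 := hp.eq_two_or_odd.resolve_left (by omega)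
  have hmod : p ^ (4 * k + 4) % 8 = 1 := by
    rw [show 4 * k + 4 = (2 * k + 2) * 2 by ring, pow_mul]
    exact sq_mod_eight_of_odd (by simp [Nat.pow_mod, hodd])
  have hN : 8 * (p ^ (4 * k + 3) * n + 3 * (p ^ (4 * k + 4) - 1) / 8) + 3
      = p ^ (4 * k + 3) * (8 * n + 3 * p) := by
    have : p ^ (4 * k + 3) * (8 * n + 3 * p) = 8 * (p ^ (4 * k + 3) * n) + 3 * p ^ (4 * k + 4) := by
      ring
    omega
  rw [Nat.modEq_zero_iff_dvd, ← even_iff_two_dvd]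
  apply even_B_eight_three_of_even_card_reps
  have h8 : (8 * (p ^ (4 * k + 3) * n + 3 * (p ^ (4 * k + 4) - 1) / 8) + 3) % 8 = 3 := by omega
  rw [hN] at h8 ⊢
  refine ZsqrtdNegTwo.even_card_reps_pow_mul hp hp5 (fun h => hn ?_) k h8
  have h1 : p ∣ 8 * n := (Nat.dvd_add_left (dvd_mul_left p 3)).mp h
  refine (hp.dvd_mul.mp h1).resolve_left fun h2 => ?_
  have := (Nat.prime_dvd_prime_iff_eq hp Nat.prime_two).mp
    (hp.dvd_of_dvd_pow (show p ∣ 2 ^ 3 from h2))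
  omega
end
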